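/- There exists δ₀ > 0 such that for every δ ∈ (0, δ₀] the static shell has single-well structure: for every L ≥ L₀, if the set I^δ_L := {r > 2M : Ψ^δ_L(r) < E^δ and ρ^δ(r) > 0} is nonempty, then there exists exactly one r_L ∈ I^δ_L with (Ψ^δ_L)′(r_L) = 0. -/

import Mathlib

open Real MeasureTheory Set Filter Topology intervalIntegral

noncomputable section

/-- The Schwarzschild effective potential. -/
def Psi0 (M L r : ℝ) : ℝ :=
  Real.sqrt (1 - 2 * M / r) * Real.sqrt (1 + L / r ^ 2)

/-- The constant `c_l`. -/
def cConst (l : ℝ) : ℝ := ∫ s in (0:ℝ)..1, s ^ l / Real.sqrt (1 - s)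

/-- The constant `d_l`. -/
def dConst (l : ℝ) : ℝ := ∫ s in (0:ℝ)..1, s ^ l * Real.sqrt (1 - s)

/-- The function `G(r,y)`. -/
def Gfun (l L₀ : ℝ) (Φ : ℝ → ℝ) (r y : ℝ) : ℝ :=
  if Real.exp (-y) * Real.sqrt (1 + L₀ / r ^ 2) < 1 then
    2 * π * cConst l * r ^ (2 * l) * Real.exp (3 * y) *
      ∫ α in (0:ℝ)..(1 - Real.exp (-y) * Real.sqrt (1 + L₀ / r ^ 2)),
        Φ α * (1 - α) ^ 2 *
          (Real.exp (2 * y) * (1 - α) ^ 2 - 1 - L₀ / r ^ 2) ^ (l + 1 / 2)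
  else 0

/-- The function `H(r,y)`. -/
def Hfun (l L₀ : ℝ) (Φ : ℝ → ℝ) (r y : ℝ) : ℝ :=
  if Real.exp (-y) * Real.sqrt (1 + L₀ / r ^ 2) < 1 then
    2 * π * dConst l * r ^ (2 * l) * Real.exp y *
      ∫ α in (0:ℝ)..(1 - Real.exp (-y) * Real.sqrt (1 + L₀ / r ^ 2)),
        Φ α * (Real.exp (2 * y) * (1 - α) ^ 2 - 1 - L₀ / r ^ 2) ^ (l + 3 / 2)
  else 0

/-- `ρ[y]`. -/
def rhoFun (l L₀ δ r₀ : ℝ) (Φ χ : ℝ → ℝ) (y : ℝ → ℝ) (r : ℝ) : ℝ :=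
  δ * χ (r - r₀) * Gfun l L₀ Φ r (y r)

/-- `p[y]`. -/
def pFun (l L₀ δ r₀ : ℝ) (Φ χ : ℝ → ℝ) (y : ℝ → ℝ) (r : ℝ) : ℝ :=
  δ * χ (r - r₀) * Hfun l L₀ Φ r (y r)

/-- `m[y]`. -/
def mFun (M l L₀ δ r₀ : ℝ) (Φ χ : ℝ → ℝ) (y : ℝ → ℝ) (r : ℝ) : ℝ :=
  4 * π * ∫ s in (2 * M)..r, s ^ 2 * rhoFun l L₀ δ r₀ Φ χ y s

/-- `y` is a `C¹` solution of the initial value problem on `(2M,∞)`. -/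
def IsShellSolution (M l L₀ δ r₀ y₀ : ℝ) (Φ χ : ℝ → ℝ) (y : ℝ → ℝ) : Prop :=
  ContinuousOn (deriv y) (Ioi (2 * M)) ∧
  y (4 * M) = y₀ ∧
  ∀ r ∈ Ioi (2 * M),
    HasDerivAt y
      (-(1 - (2 / r) * (M + mFun M l L₀ δ r₀ Φ χ y r))⁻¹ *
        ((M + mFun M l L₀ δ r₀ Φ χ y r) / r ^ 2 +
          4 * π * r * pFun l L₀ δ r₀ Φ χ y r)) r

/-- If all values `f s` with `s ≤ x` are at most `K` in size, a smooth function vanishing on the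
negative half-line satisfies `|f' x| ^ (N + 1) ≤ C * K ^ N`. -/
theorem flat_deriv_bound (B : ℝ) (N : ℕ) : ∀ f : ℝ → ℝ, ContDiff ℝ (⊤ : ℕ∞) f →
    (∀ x ≤ 0, f x = 0) → ∃ C : ℝ, 0 ≤ C ∧ ∀ x ≤ B, ∀ K : ℝ, (∀ s ≤ x, |f s| ≤ K) →
      |deriv f x| ^ (N + 1) ≤ C * K ^ N := by
  have flat' : ∀ f : ℝ → ℝ, ContDiff ℝ (⊤ : ℕ∞) f → (∀ x ≤ 0, f x = 0) →
      ∀ x ≤ 0, deriv f x = 0 := by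
    intro f hf h0 x hx
    have hd : DifferentiableAt ℝ f x := (hf.differentiable (by simp)).differentiableAt
    have h1 : HasDerivWithinAt f (deriv f x) (Iic x) x := hd.hasDerivAt.hasDerivWithinAt
    have h2 : HasDerivWithinAt f 0 (Iic x) x :=
      (hasDerivWithinAt_const x (Iic x) (0:ℝ)).congr (fun s hs => h0 s (le_trans hs hx)) (h0 x hx)
    exact (uniqueDiffWithinAt_Iic x).eq_deriv _ h1 h2
  have maxi : ∀ g : ℝ → ℝ, Continuous g → (∀ x ≤ 0, g x = 0) → ∀ x : ℝ,
      ∃ s₀ ≤ x, ∀ s ≤ x, |g s| ≤ |g s₀| := by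
    intro g hg h0 x
    rcases le_total x 0 with hx | hx
    · exact ⟨x, le_rfl, fun s hs => by rw [h0 s (hs.trans hx), h0 x hx]⟩
    · obtain ⟨s₀, hs₀, hmax⟩ := (isCompact_Icc (a := (0:ℝ)) (b := x)).exists_isMaxOn
        (nonempty_Icc.2 hx) (hg.abs.continuousOn)
      refine ⟨s₀, hs₀.2, fun s hs => ?_⟩
      rcases le_total s 0 with h | h
      · rw [h0 s h, abs_zero]; positivity
      · exact hmax ⟨h, hs⟩
  induction N with
  | zero =>
    intro f hf h0
    have hc : Continuous (deriv f) := hf.continuous_deriv (by simp)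
    obtain ⟨s₀, -, hs₀⟩ := maxi _ hc (flat' f hf h0) B
    exact ⟨|deriv f s₀|, abs_nonneg _, fun x hx K _ => by simpa using hs₀ x hx⟩
  | succ N ih =>
    intro f hf h0
    have hf' : ContDiff ℝ (⊤ : ℕ∞) (deriv f) := (contDiff_infty_iff_deriv.1 hf).2
    have hf'' : ContDiff ℝ (⊤ : ℕ∞) (deriv (deriv f)) := (contDiff_infty_iff_deriv.1 hf').2
    have h0' := flat' f hf h0
    have h0'' := flat' _ hf' h0'
    obtain ⟨C, hC0, hC⟩ := ih (deriv f) hf' h0'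
    refine ⟨8 ^ (N + 1) * C, by positivity, fun x hx K hK => ?_⟩
    have hK0 : 0 ≤ K := (abs_nonneg _).trans (hK x le_rfl)
    obtain ⟨s₁, hs₁, hm₁⟩ := maxi _ hf'.continuous h0' x
    obtain ⟨s₂, hs₂, hm₂⟩ := maxi _ hf''.continuous h0'' x
    set K₁ := |deriv f s₁| with hK₁
    set K₂ := |deriv (deriv f) s₂| with hK₂
    have hK₁0 : 0 ≤ K₁ := abs_nonneg _
    have hK₂0 : 0 ≤ K₂ := abs_nonneg _
    have h2 : K₂ ^ (N + 1) ≤ C * K₁ ^ N :=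
      hC s₂ (hs₂.trans hx) K₁ (fun s hs => hm₁ s (hs.trans hs₂))
    have step : ∀ h : ℝ, 0 < h → h * K₁ ≤ 2 * K + h ^ 2 * K₂ := by
      intro h hh
      obtain ⟨ξ, hξ, hξe⟩ := exists_deriv_eq_slope f (show s₁ - h < s₁ by linarith)
        hf.continuous.continuousOn (hf.differentiable (by simp)).differentiableOn
      have e1 : h * deriv f ξ = f s₁ - f (s₁ - h) := by
        rw [hξe, sub_sub_cancel, mul_div_cancel₀ _ hh.ne']
      have e2 : |deriv f s₁ - deriv f ξ| ≤ K₂ * |s₁ - ξ| := by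
        refine Convex.norm_image_sub_le_of_norm_deriv_le (s := Iic x) (f := deriv f)
          (fun z _ => (hf'.differentiable (by simp)).differentiableAt)
          (fun z hz => hm₂ z hz) (convex_Iic x) ?_ hs₁
        exact le_of_lt (lt_of_lt_of_le hξ.2 hs₁)
      have e3 : |s₁ - ξ| ≤ h := by rw [abs_of_pos (by linarith [hξ.2])]; linarith [hξ.1]
      have e4 : K₁ ≤ |deriv f ξ| + K₂ * h := by
        have : |deriv f s₁| ≤ |deriv f ξ| + |deriv f s₁ - deriv f ξ| := by
          have := abs_add_le (deriv f ξ) (deriv f s₁ - deriv f ξ)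
          simpa using this
        have := mul_le_mul_of_nonneg_left e3 hK₂0
        linarith
      have e5 : h * |deriv f ξ| ≤ 2 * K := by
        have : |h * deriv f ξ| ≤ 2 * K := by
          rw [e1]
          have := abs_sub (f s₁) (f (s₁ - h))
          have a1 := hK s₁ hs₁
          have a2 := hK (s₁ - h) (by linarith)
          linarith
        rwa [abs_mul, abs_of_pos hh] at this
      nlinarith [mul_le_mul_of_nonneg_left e4 hh.le]
    have key : K₁ ^ 2 ≤ 8 * K * K₂ := by
      rcases hK₂0.eq_or_lt with h | h
      · have : K₁ ≤ 0 := by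
          by_contra! hpos
          have := step ((2 * K + 1) / K₁) (by positivity)
          rw [← h, div_mul_cancel₀ _ hpos.ne', mul_zero] at this
          linarith
        have : K₁ = 0 := le_antisymm this hK₁0
        rw [this, ← h]; simp
      · rcases hK₁0.eq_or_lt with h1 | h1
        · rw [← h1]; simp; positivity
        · have := step (K₁ / (2 * K₂)) (by positivity)
          field_simp at this
          nlinarith
    have h3 : |deriv f x| ≤ K₁ := hm₁ x le_rfl
    have h4 : K₁ ^ (N + 2) ≤ 8 ^ (N + 1) * C * K ^ (N + 1) := by
      rcases hK₁0.eq_or_lt with h1 | h1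
      · rw [← h1]; simp; positivity
      · have : K₁ ^ (N + 2) * K₁ ^ N ≤ 8 ^ (N + 1) * C * K ^ (N + 1) * K₁ ^ N := by
          calc K₁ ^ (N + 2) * K₁ ^ N = (K₁ ^ 2) ^ (N + 1) := by ring
            _ ≤ (8 * K * K₂) ^ (N + 1) := by gcongr
            _ = 8 ^ (N + 1) * K ^ (N + 1) * K₂ ^ (N + 1) := by ring
            _ ≤ 8 ^ (N + 1) * K ^ (N + 1) * (C * K₁ ^ N) := by gcongr
            _ = _ := by ring
        exact le_of_mul_le_mul_right this (by positivity)
    calc |deriv f x| ^ (N + 1 + 1) ≤ K₁ ^ (N + 2) := by gcongr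
      _ ≤ _ := h4

/-- The primitive of a smooth nonnegative function vanishing on the negative half-line controls
the function with an exponent arbitrarily close to one. -/
theorem flat_primitive_bound (χ : ℝ → ℝ) (hχ : ContDiff ℝ (⊤ : ℕ∞) χ) (hχ0 : ∀ x ≤ 0, χ x = 0)
    (hχnonneg : ∀ x, 0 ≤ χ x) (B : ℝ) (N : ℕ) :
    ∃ C : ℝ, 0 < C ∧ ∀ x ≤ B, χ x ^ (N + 1) ≤ C * (∫ s in (0:ℝ)..x, χ s) ^ N := by
  set X : ℝ → ℝ := fun x => ∫ s in (0:ℝ)..x, χ s with hX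
  have hd : ∀ x, HasDerivAt X (χ x) x := fun x =>
    intervalIntegral.integral_hasDerivAt_right (hχ.continuous.intervalIntegrable _ _)
      (hχ.continuous.stronglyMeasurableAtFilter _ _) hχ.continuous.continuousAt
  have hder : deriv X = χ := funext fun x => (hd x).deriv
  have hXs : ContDiff ℝ (⊤ : ℕ∞) X :=
    contDiff_infty_iff_deriv.2 ⟨fun x => (hd x).differentiableAt, by rwa [hder]⟩
  have hmono : Monotone X := monotone_of_deriv_nonneg (fun x => (hd x).differentiableAt)
    (fun x => by rw [hder]; exact hχnonneg x)
  have hX0 : ∀ x ≤ 0, X x = 0 := by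
    intro x hx
    simp only [hX]
    rw [intervalIntegral.integral_congr (g := fun _ => (0:ℝ))]
    · simp
    · intro s hs
      rw [uIcc_of_ge hx] at hs
      exact hχ0 s hs.2
  have hXn : ∀ x, 0 ≤ X x := fun x => by
    rcases le_total x 0 with h | h
    · rw [hX0 x h]
    · rw [← hX0 0 le_rfl]; exact hmono h
  obtain ⟨C, hC0, hC⟩ := flat_deriv_bound B N X hXs hX0
  refine ⟨C + 1, by positivity, fun x hx => ?_⟩
  have := hC x hx (X x) (fun s hs => by rw [abs_of_nonneg (hXn s)]; exact hmono hs)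
  rw [hder, abs_of_nonneg (hχnonneg x)] at this
  refine this.trans ?_
  have := pow_nonneg (hXn x) N
  change C * X x ^ N ≤ (C + 1) * X x ^ N
  nlinarith

/-- The integral over the cut-off energies, with the integrand extended by zero. -/
def cutoffIntegral (Φ w : ℝ → ℝ) (e E B : ℝ) : ℝ :=
  ∫ α in (0:ℝ)..1, Φ α * (w α * (max (E * (1 - α) ^ 2 - B) 0) ^ e)

theorem intervalIntegrable_of_locallyBounded {Φ : ℝ → ℝ} (hΦmeas : Measurable Φ)
    (hΦnonneg : ∀ x, 0 ≤ Φ x) (hΦloc : ∀ a b : ℝ, BddAbove (Φ '' Icc a b)) (a b : ℝ) :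
    IntervalIntegrable Φ volume a b := by
  wlog hab : a ≤ b generalizing a b
  · exact (this b a (le_of_not_ge hab)).symm
  obtain ⟨S, hS⟩ := hΦloc a b
  refine IntervalIntegrable.mono_fun' (g := fun _ => S) (by simp)
    hΦmeas.aestronglyMeasurable ?_
  refine (ae_restrict_iff' measurableSet_uIoc).2 (Eventually.of_forall fun x hx => ?_)
  rw [uIoc_of_le hab] at hx
  change ‖Φ x‖ ≤ S
  rw [Real.norm_of_nonneg (hΦnonneg x)]
  exact hS ⟨x, ⟨hx.1.le, hx.2⟩, rfl⟩

section Cutoff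

variable {Φ w : ℝ → ℝ} {e : ℝ}

theorem continuous_cutoff_integrand (hw : Continuous w) (he : 0 < e) (E B : ℝ) :
    Continuous fun α => w α * (max (E * (1 - α) ^ 2 - B) 0) ^ e := by
  refine hw.mul (Continuous.rpow_const (by fun_prop) fun _ => Or.inr he.le)

theorem cutoff_integrable (hΦ : ∀ a b : ℝ, IntervalIntegrable Φ volume a b) (hw : Continuous w)
    (he : 0 < e) (E B a b : ℝ) :
    IntervalIntegrable (fun α => Φ α * (w α * (max (E * (1 - α) ^ 2 - B) 0) ^ e)) volume a b :=
  (hΦ a b).mul_continuousOn (continuous_cutoff_integrand hw he E B).continuousOn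

/-- Above the threshold the integral only runs up to the zero of the cut-off. -/
theorem cutoffIntegral_eq (hΦ : ∀ a b : ℝ, IntervalIntegrable Φ volume a b) (hw : Continuous w)
    (he : 0 < e) {y B : ℝ} (hB : 0 < B) (h : Real.exp (-y) * Real.sqrt B < 1) :
    cutoffIntegral Φ w e (Real.exp (2 * y)) B =
      ∫ α in (0:ℝ)..(1 - Real.exp (-y) * Real.sqrt B),
        Φ α * (w α * (Real.exp (2 * y) * (1 - α) ^ 2 - B) ^ e) := by
  set T := Real.exp (-y) * Real.sqrt B with hT
  have hT0 : 0 < T := by positivity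
  have hTsq : Real.exp (2 * y) * T ^ 2 = B := by
    rw [hT, mul_pow, Real.sq_sqrt hB.le, ← mul_assoc, ← Real.exp_nat_mul, ← Real.exp_add]
    simp
  have hE := Real.exp_pos (2 * y)
  unfold cutoffIntegral
  rw [← intervalIntegral.integral_add_adjacent_intervals
    (cutoff_integrable hΦ hw he _ B 0 (1 - T)) (cutoff_integrable hΦ hw he _ B (1 - T) 1)]
  have h2 : ∫ α in (1 - T)..1, Φ α * (w α * (max (Real.exp (2 * y) * (1 - α) ^ 2 - B) 0) ^ e)
      = 0 := by
    rw [intervalIntegral.integral_congr (g := fun _ => (0:ℝ))]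
    · simp
    · intro α hα
      rw [uIcc_of_le (by linarith)] at hα
      have h1 : (1 - α) ^ 2 ≤ T ^ 2 :=
        pow_le_pow_left₀ (by linarith [hα.2]) (by linarith [hα.1]) 2
      have : Real.exp (2 * y) * (1 - α) ^ 2 - B ≤ 0 := by
        have := mul_le_mul_of_nonneg_left h1 hE.le
        linarith
      simp [max_eq_right this, Real.zero_rpow he.ne']
  rw [h2, add_zero]
  refine intervalIntegral.integral_congr fun α hα => ?_
  rw [uIcc_of_le (by linarith)] at hα
  have h1 : T ^ 2 ≤ (1 - α) ^ 2 := pow_le_pow_left₀ hT0.le (by linarith [hα.2]) 2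
  have : 0 ≤ Real.exp (2 * y) * (1 - α) ^ 2 - B := by
    have := mul_le_mul_of_nonneg_left h1 hE.le
    linarith
  simp only [max_eq_left this]

theorem cutoffIntegral_eq_zero (he : 0 < e) {E B : ℝ} (hE : 0 ≤ E) (h : E ≤ B) :
    cutoffIntegral Φ w e E B = 0 := by
  unfold cutoffIntegral
  rw [intervalIntegral.integral_congr (g := fun _ => (0:ℝ))]
  · simp
  · intro α hα
    rw [uIcc_of_le zero_le_one] at hα
    have h1 : (1 - α) ^ 2 ≤ 1 := pow_le_one₀ (by linarith [hα.2]) (by linarith [hα.1])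
    have : E * (1 - α) ^ 2 - B ≤ 0 := by nlinarith
    simp [max_eq_right this, Real.zero_rpow he.ne']

theorem cutoffIntegral_nonneg (hΦ0 : ∀ x, 0 ≤ Φ x) (hw0 : ∀ x, 0 ≤ w x) (E B : ℝ) :
    0 ≤ cutoffIntegral Φ w e E B :=
  intervalIntegral.integral_nonneg zero_le_one fun α _ =>
    mul_nonneg (hΦ0 α) (mul_nonneg (hw0 α) (Real.rpow_nonneg (le_max_right _ _) _))

theorem cutoffIntegral_le (hΦ : ∀ a b : ℝ, IntervalIntegrable Φ volume a b)
    (hΦ0 : ∀ x, 0 ≤ Φ x) (hw : Continuous w) (hw1 : ∀ x ∈ Icc (0:ℝ) 1, w x ≤ 1) (he : 0 < e)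
    {E B : ℝ} (hE : 0 ≤ E) (hB : 0 ≤ B) :
    cutoffIntegral Φ w e E B ≤ (∫ α in (0:ℝ)..1, Φ α) * E ^ e := by
  rw [← intervalIntegral.integral_mul_const]
  refine intervalIntegral.integral_mono_on zero_le_one (cutoff_integrable hΦ hw he E B 0 1)
    ((hΦ 0 1).mul_const _) fun α hα => ?_
  refine mul_le_mul_of_nonneg_left ?_ (hΦ0 α)
  have h1 : (1 - α) ^ 2 ≤ 1 := pow_le_one₀ (by linarith [hα.2]) (by linarith [hα.1])
  have h2 : max (E * (1 - α) ^ 2 - B) 0 ≤ E := max_le (by nlinarith) hE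
  have h3 := Real.rpow_le_rpow (le_max_right _ _) h2 he.le
  have h4 := Real.rpow_nonneg (le_max_right (E * (1 - α) ^ 2 - B) 0) e
  nlinarith [hw1 α hα]

theorem cutoffIntegral_pos (hΦ : ∀ a b : ℝ, IntervalIntegrable Φ volume a b)
    (hΦ0 : ∀ x, 0 ≤ Φ x) {α₀ : ℝ} (hα₀ : 0 < α₀) (hΦpos : ∀ x ∈ Ioo 0 α₀, 0 < Φ x)
    (hw : Continuous w) (hw0 : ∀ x, 0 ≤ w x) (hwpos : ∀ x < 1, 0 < w x) (he : 0 < e)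
    {E B : ℝ} (hB : 0 < B) (h : B < E) : 0 < cutoffIntegral Φ w e E B := by
  have hE : 0 < E := hB.trans h
  set T := Real.sqrt (B / E) with hT
  have hT1 : T < 1 := by
    rw [hT, Real.sqrt_lt' one_pos, one_pow, div_lt_one hE]; exact h
  have hT0 : 0 ≤ T := Real.sqrt_nonneg _
  have hTs : E * T ^ 2 = B := by rw [hT, Real.sq_sqrt (by positivity)]; field_simp
  set β := min α₀ (1 - T) with hβ
  have hβ0 : 0 < β := lt_min hα₀ (by linarith)
  have hβ1 : β ≤ 1 - T := min_le_right _ _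
  have hint := cutoff_integrable hΦ hw he E B
  have hnn : ∀ α, 0 ≤ Φ α * (w α * (max (E * (1 - α) ^ 2 - B) 0) ^ e) := fun α =>
    mul_nonneg (hΦ0 α) (mul_nonneg (hw0 α) (Real.rpow_nonneg (le_max_right _ _) _))
  have h1 : 0 < ∫ α in (0:ℝ)..β, Φ α * (w α * (max (E * (1 - α) ^ 2 - B) 0) ^ e) := by
    refine intervalIntegral.intervalIntegral_pos_of_pos_on (hint 0 β) (fun α hα => ?_) hβ0
    have hα1 : α < 1 - T := hα.2.trans_le hβ1
    have : 0 < E * (1 - α) ^ 2 - B := by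
      have : T ^ 2 < (1 - α) ^ 2 := pow_lt_pow_left₀ (by linarith) hT0 (by norm_num)
      have := mul_lt_mul_of_pos_left this hE
      linarith
    exact mul_pos (hΦpos α ⟨hα.1, hα.2.trans_le (min_le_left _ _)⟩)
      (mul_pos (hwpos α (by linarith)) (Real.rpow_pos_of_pos (lt_max_of_lt_left this) _))
  have h2 : 0 ≤ ∫ α in β..1, Φ α * (w α * (max (E * (1 - α) ^ 2 - B) 0) ^ e) :=
    intervalIntegral.integral_nonneg (by linarith) fun α _ => hnn α
  unfold cutoffIntegral
  rw [← intervalIntegral.integral_add_adjacent_intervals (hint 0 β) (hint β 1)]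
  linarith

theorem le_cutoffIntegral (hΦ : ∀ a b : ℝ, IntervalIntegrable Φ volume a b)
    (hΦ0 : ∀ x, 0 ≤ Φ x) (he : 0 < e) {E B : ℝ} (hE : 0 ≤ E) (h : 8 * B ≤ E) :
    (∫ α in (0:ℝ)..(1 / 2), Φ α) * (E / 8) ^ e ≤ cutoffIntegral Φ (fun _ => 1) e E B := by
  have hint := cutoff_integrable hΦ (continuous_const (y := (1:ℝ))) he E B
  have h2 : 0 ≤ ∫ α in (1/2:ℝ)..1, Φ α * (1 * (max (E * (1 - α) ^ 2 - B) 0) ^ e) :=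
    intervalIntegral.integral_nonneg (by norm_num) fun α _ =>
      mul_nonneg (hΦ0 α) (mul_nonneg zero_le_one (Real.rpow_nonneg (le_max_right _ _) _))
  unfold cutoffIntegral
  rw [← intervalIntegral.integral_add_adjacent_intervals (hint 0 (1 / 2)) (hint (1 / 2) 1),
    ← intervalIntegral.integral_mul_const]
  refine le_add_of_le_of_nonneg ?_ h2
  refine intervalIntegral.integral_mono_on (by norm_num) ((hΦ _ _).mul_const _) (hint _ _)
    fun α hα => ?_
  refine mul_le_mul_of_nonneg_left ?_ (hΦ0 α)
  rw [one_mul]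
  refine Real.rpow_le_rpow (by positivity) (le_max_of_le_left ?_) he.le
  have : (1 / 2 : ℝ) ^ 2 ≤ (1 - α) ^ 2 :=
    pow_le_pow_left₀ (by norm_num) (by linarith [hα.2]) 2
  nlinarith

theorem continuous_cutoffIntegral (hΦmeas : Measurable Φ)
    (hΦ : ∀ a b : ℝ, IntervalIntegrable Φ volume a b)
    (hΦ0 : ∀ x, 0 ≤ Φ x) (hw : Continuous w) (hw0 : ∀ x, 0 ≤ w x)
    (hw1 : ∀ x ∈ Icc (0:ℝ) 1, w x ≤ 1) (he : 0 < e) :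
    Continuous fun q : ℝ × ℝ => cutoffIntegral Φ w e q.1 q.2 := by
  rw [continuous_iff_continuousAt]
  intro q₀
  set S := (|q₀.1| + 1) + (|q₀.2| + 1) with hS
  refine intervalIntegral.continuousAt_of_dominated_interval (bound := fun α => Φ α * S ^ e)
    ?_ ?_ ((hΦ 0 1).mul_const _) ?_
  · exact Eventually.of_forall fun q => (hΦmeas.mul
      (continuous_cutoff_integrand hw he q.1 q.2).measurable).aestronglyMeasurable
  · have h1 : ∀ᶠ q : ℝ × ℝ in 𝓝 q₀, |q.1| < |q₀.1| + 1 :=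
      (continuous_fst.abs.continuousAt (x := q₀)).eventually_lt_const (by simp)
    have h2 : ∀ᶠ q : ℝ × ℝ in 𝓝 q₀, |q.2| < |q₀.2| + 1 :=
      (continuous_snd.abs.continuousAt (x := q₀)).eventually_lt_const (by simp)
    filter_upwards [h1, h2] with q hq1 hq2
    refine Eventually.of_forall fun α hα => ?_
    rw [uIoc_of_le zero_le_one] at hα
    rw [Real.norm_of_nonneg (mul_nonneg (hΦ0 α)
      (mul_nonneg (hw0 α) (Real.rpow_nonneg (le_max_right _ _) _)))]
    refine mul_le_mul_of_nonneg_left ?_ (hΦ0 α)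
    have hle : (1 - α) ^ 2 ≤ 1 := pow_le_one₀ (by linarith [hα.2]) (by linarith [hα.1])
    have hS0 : 0 ≤ S := by positivity
    have h3 : max (q.1 * (1 - α) ^ 2 - q.2) 0 ≤ S := by
      refine max_le ?_ hS0
      have : q.1 * (1 - α) ^ 2 ≤ |q.1| := by
        calc q.1 * (1 - α) ^ 2 ≤ |q.1| * (1 - α) ^ 2 :=
              mul_le_mul_of_nonneg_right (le_abs_self _) (sq_nonneg _)
          _ ≤ |q.1| * 1 := mul_le_mul_of_nonneg_left hle (abs_nonneg _)
          _ = _ := mul_one _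
      linarith [neg_abs_le q.2]
    have h4 := Real.rpow_le_rpow (le_max_right _ _) h3 he.le
    have h5 := Real.rpow_nonneg (le_max_right (q.1 * (1 - α) ^ 2 - q.2) 0) e
    nlinarith [hw1 α ⟨hα.1.le, hα.2⟩]
  · refine Eventually.of_forall fun α _ => ?_
    refine Continuous.continuousAt ?_
    refine continuous_const.mul (continuous_const.mul ?_)
    exact Continuous.rpow_const (by fun_prop) fun _ => Or.inr he.le

theorem rpow_lipschitz (he : 1 ≤ e) {S x z : ℝ} (hx : 0 ≤ x) (hxS : x ≤ S) (hz : 0 ≤ z)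
    (hzS : z ≤ S) : |x ^ e - z ^ e| ≤ e * S ^ (e - 1) * |x - z| := by
  have h := Convex.norm_image_sub_le_of_norm_hasDerivWithin_le (s := Icc 0 S)
    (f := fun t : ℝ => t ^ e) (f' := fun t => e * t ^ (e - 1)) (C := e * S ^ (e - 1))
    (fun t _ => (Real.hasDerivAt_rpow_const (Or.inr he)).hasDerivWithinAt)
    (fun t ht => ?_) (convex_Icc 0 S) (x := z) (y := x) ⟨hz, hzS⟩ ⟨hx, hxS⟩
  · simpa using h
  · rw [Real.norm_of_nonneg (mul_nonneg (by linarith) (Real.rpow_nonneg ht.1 _))]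
    exact mul_le_mul_of_nonneg_left (Real.rpow_le_rpow ht.1 ht.2 (by linarith)) (by linarith)

theorem cutoffIntegral_lipschitz (hΦ : ∀ a b : ℝ, IntervalIntegrable Φ volume a b)
    (hΦ0 : ∀ x, 0 ≤ Φ x) (he : 1 ≤ e) {S E E' B B' : ℝ} (hE : 0 ≤ E) (hES : E ≤ S)
    (hES' : E' ≤ S) (hB : 0 ≤ B) (hB' : 0 ≤ B') :
    |cutoffIntegral Φ (fun _ => 1) e E B - cutoffIntegral Φ (fun _ => 1) e E' B'| ≤
      (∫ α in (0:ℝ)..1, Φ α) * (e * S ^ (e - 1) * (|E - E'| + |B - B'|)) := by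
  have he0 : 0 < e := by linarith
  have hint := fun E B => cutoff_integrable hΦ (continuous_const (y := (1:ℝ))) he0 E B 0 1
  unfold cutoffIntegral
  rw [← intervalIntegral.integral_sub (hint E B) (hint E' B'),
    ← intervalIntegral.integral_mul_const, ← Real.norm_eq_abs]
  refine intervalIntegral.norm_integral_le_of_norm_le zero_le_one ?_ ((hΦ 0 1).mul_const _)
  refine Eventually.of_forall fun α hα => ?_
  rw [← mul_sub, norm_mul, Real.norm_of_nonneg (hΦ0 α)]
  refine mul_le_mul_of_nonneg_left ?_ (hΦ0 α)
  have hle : (1 - α) ^ 2 ≤ 1 := pow_le_one₀ (by linarith [hα.2]) (by linarith [hα.1])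
  have hnn : 0 ≤ (1 - α) ^ 2 := sq_nonneg _
  have hS : 0 ≤ S := hE.trans hES
  have h1 : max (E * (1 - α) ^ 2 - B) 0 ≤ S := max_le (by nlinarith) hS
  have h2 : max (E' * (1 - α) ^ 2 - B') 0 ≤ S := max_le (by nlinarith) hS
  rw [one_mul, one_mul, Real.norm_eq_abs]
  refine (rpow_lipschitz he (le_max_right _ _) h1 (le_max_right _ _) h2).trans ?_
  refine mul_le_mul_of_nonneg_left ?_ (mul_nonneg he0.le (Real.rpow_nonneg hS _))
  refine (abs_max_sub_max_le_abs _ _ _).trans ?_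
  have : E * (1 - α) ^ 2 - B - (E' * (1 - α) ^ 2 - B') = (E - E') * (1 - α) ^ 2 - (B - B') := by
    ring
  rw [this]
  refine (abs_sub _ _).trans (add_le_add ?_ le_rfl)
  rw [abs_mul, abs_of_nonneg hnn]
  nlinarith [abs_nonneg (E - E')]

end Cutoff

theorem exists_lipschitz_Icc {f f' : ℝ → ℝ} {a b : ℝ}
    (hf : ∀ x ∈ Icc a b, HasDerivAt f (f' x) x) (hf' : ContinuousOn f' (Icc a b)) :
    ∃ K : ℝ, 0 ≤ K ∧ ∀ x ∈ Icc a b, ∀ z ∈ Icc a b, |f x - f z| ≤ K * |x - z| := by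
  obtain ⟨K, hK⟩ := isCompact_Icc.exists_bound_of_continuousOn hf'
  refine ⟨max K 0, le_max_right _ _, fun x hx z hz => ?_⟩
  exact Convex.norm_image_sub_le_of_norm_hasDerivWithin_le
    (fun t ht => (hf t ht).hasDerivWithinAt) (fun t ht => (hK t ht).trans (le_max_left _ _))
    (convex_Icc a b) hz hx

theorem abs_mul_sub_mul_le {x x' z z' X Z K₁ K₂ D : ℝ} (hX : |x| ≤ X) (hZ : |z'| ≤ Z)
    (h₁ : |x - x'| ≤ K₁ * D) (h₂ : |z - z'| ≤ K₂ * D) :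
    |x * z - x' * z'| ≤ (X * K₂ + Z * K₁) * D := by
  have : x * z - x' * z' = x * (z - z') + (x - x') * z' := by ring
  rw [this]
  refine (abs_add_le _ _).trans ?_
  rw [abs_mul, abs_mul]
  have e1 : |x| * |z - z'| ≤ X * (K₂ * D) :=
    mul_le_mul hX h₂ (abs_nonneg _) ((abs_nonneg _).trans hX)
  have e2 : |x - x'| * |z'| ≤ K₁ * D * Z :=
    mul_le_mul h₁ hZ (abs_nonneg _) ((abs_nonneg _).trans h₁)
  linarith

theorem dConst_pos {l : ℝ} (hl : -(1/2) < l) : 0 < dConst l := by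
  unfold dConst
  refine intervalIntegral.intervalIntegral_pos_of_pos_on ?_ (fun s hs => ?_) one_pos
  · exact (intervalIntegral.intervalIntegrable_rpow' (by linarith)).mul_continuousOn (by fun_prop)
  · exact mul_pos (Real.rpow_pos_of_pos hs.1 _) (Real.sqrt_pos.2 (by linarith [hs.2]))

theorem cConst_nonneg (l : ℝ) : 0 ≤ cConst l :=
  intervalIntegral.integral_nonneg zero_le_one fun _ hs =>
    div_nonneg (Real.rpow_nonneg hs.1 _) (Real.sqrt_nonneg _)

section Matter

variable {l L₀ : ℝ} {Φ : ℝ → ℝ}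

theorem cutoff_cond_iff {y B : ℝ} : Real.exp (-y) * Real.sqrt B < 1 ↔ B < Real.exp (2 * y) := by
  rw [Real.exp_neg, inv_mul_lt_one₀ (Real.exp_pos y), Real.sqrt_lt' (Real.exp_pos y),
    ← Real.exp_nat_mul]
  simp

theorem Gfun_eq (hΦ : ∀ a b : ℝ, IntervalIntegrable Φ volume a b) (hl : -(1/2) < l)
    (hL₀ : 0 ≤ L₀) (r y : ℝ) :
    Gfun l L₀ Φ r y = 2 * π * cConst l * r ^ (2 * l) * Real.exp (3 * y) *
      cutoffIntegral Φ (fun α => (1 - α) ^ 2) (l + 1 / 2) (Real.exp (2 * y)) (1 + L₀ / r ^ 2) := by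
  have hB : 0 < 1 + L₀ / r ^ 2 := by positivity
  unfold Gfun
  split_ifs with h
  · rw [cutoffIntegral_eq hΦ (by fun_prop) (by linarith) hB h]
    simp only [sub_sub, mul_assoc]
  · rw [cutoffIntegral_eq_zero (by linarith) (Real.exp_pos _).le
      (not_lt.1 (fun h' => h (cutoff_cond_iff.2 h'))), mul_zero]

theorem Hfun_eq (hΦ : ∀ a b : ℝ, IntervalIntegrable Φ volume a b) (hl : -(1/2) < l)
    (hL₀ : 0 ≤ L₀) (r y : ℝ) :
    Hfun l L₀ Φ r y = 2 * π * dConst l * r ^ (2 * l) * Real.exp y *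
      cutoffIntegral Φ (fun _ => 1) (l + 3 / 2) (Real.exp (2 * y)) (1 + L₀ / r ^ 2) := by
  have hB : 0 < 1 + L₀ / r ^ 2 := by positivity
  unfold Hfun
  split_ifs with h
  · rw [cutoffIntegral_eq hΦ (by fun_prop) (by linarith) hB h]
    simp only [sub_sub, one_mul]
  · rw [cutoffIntegral_eq_zero (by linarith) (Real.exp_pos _).le
      (not_lt.1 (fun h' => h (cutoff_cond_iff.2 h'))), mul_zero]

theorem cutoffIntegral_succ_le (hΦ : ∀ a b : ℝ, IntervalIntegrable Φ volume a b)
    (hΦ0 : ∀ x, 0 ≤ Φ x) {e : ℝ} (he : 0 < e) {E B : ℝ} (hE : 0 ≤ E) (hB : 0 ≤ B) :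
    cutoffIntegral Φ (fun _ => 1) (e + 1) E B ≤
      E * cutoffIntegral Φ (fun α => (1 - α) ^ 2) e E B := by
  unfold cutoffIntegral
  rw [← intervalIntegral.integral_const_mul]
  refine intervalIntegral.integral_mono_on zero_le_one
    (cutoff_integrable hΦ continuous_const (by linarith) E B 0 1)
    ((cutoff_integrable hΦ (by fun_prop) he E B 0 1).const_mul _) fun α _ => ?_
  have hn := Real.rpow_nonneg (le_max_right (E * (1 - α) ^ 2 - B) 0) e
  have h1 : max (E * (1 - α) ^ 2 - B) 0 ≤ E * (1 - α) ^ 2 :=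
    max_le (by linarith) (mul_nonneg hE (sq_nonneg _))
  rw [Real.rpow_add_one' (le_max_right _ _) (by linarith)]
  have h2 := mul_le_mul_of_nonneg_left h1 hn
  have h3 := mul_le_mul_of_nonneg_left h2 (hΦ0 α)
  linarith

theorem matter_nonneg (hΦ : ∀ a b : ℝ, IntervalIntegrable Φ volume a b)
    (hΦ0 : ∀ x, 0 ≤ Φ x) (hl : -(1/2) < l) (hL₀ : 0 ≤ L₀) {r : ℝ} (hr : 0 < r) (y : ℝ) :
    0 ≤ Gfun l L₀ Φ r y ∧ 0 ≤ Hfun l L₀ Φ r y := by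
  have hc := cConst_nonneg l
  have hd := (dConst_pos hl).le
  rw [Gfun_eq hΦ hl hL₀, Hfun_eq hΦ hl hL₀]
  constructor <;>
  · refine mul_nonneg (by positivity) (cutoffIntegral_nonneg hΦ0 (fun x => by positivity) _ _)

theorem matter_continuousOn (hΦmeas : Measurable Φ)
    (hΦ : ∀ a b : ℝ, IntervalIntegrable Φ volume a b)
    (hΦ0 : ∀ x, 0 ≤ Φ x) (hl : -(1/2) < l) (hL₀ : 0 ≤ L₀) {y : ℝ → ℝ} {s : Set ℝ}
    (hs : ∀ r ∈ s, 0 < r) (hy : ContinuousOn y s) :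
    ContinuousOn (fun r => Gfun l L₀ Φ r (y r)) s ∧
      ContinuousOn (fun r => Hfun l L₀ Φ r (y r)) s := by
  have hpow : ContinuousOn (fun r : ℝ => r ^ (2 * l)) s :=
    continuousOn_id.rpow_const fun r hr => Or.inl (hs r hr).ne'
  have hpair : ContinuousOn (fun r => (Real.exp (2 * y r), 1 + L₀ / r ^ 2)) s := by
    refine ContinuousOn.prodMk (by fun_prop) ?_
    exact continuousOn_const.add (continuousOn_const.div (by fun_prop)
      fun r hr => (pow_pos (hs r hr) 2).ne')
  have hw1 : ∀ x ∈ Icc (0:ℝ) 1, (1 - x) ^ 2 ≤ 1 := fun x hx =>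
    pow_le_one₀ (by linarith [hx.2]) (by linarith [hx.1])
  constructor
  · simp only [Gfun_eq hΦ hl hL₀]
    refine ((continuousOn_const.mul hpow).mul (by fun_prop)).mul ?_
    have hJ := continuous_cutoffIntegral (w := fun α => (1 - α) ^ 2) hΦmeas hΦ hΦ0 (by fun_prop)
      (fun x => sq_nonneg _) hw1 (by linarith : 0 < l + 1 / 2)
    exact (hJ.comp_continuousOn hpair).congr fun r _ => rfl
  · simp only [Hfun_eq hΦ hl hL₀]
    refine ((continuousOn_const.mul hpow).mul (by fun_prop)).mul ?_
    have hJ := continuous_cutoffIntegral (w := fun _ => 1) hΦmeas hΦ hΦ0 (by fun_prop)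
      (fun x => zero_le_one) (fun _ _ => le_rfl) (by linarith : 0 < l + 3 / 2)
    exact (hJ.comp_continuousOn hpair).congr fun r _ => rfl

theorem exists_rpow_bounds {a R : ℝ} (ha : 0 < a) (e : ℝ) :
    ∃ A A' : ℝ, 0 < A ∧ 0 < A' ∧ ∀ r ∈ Icc a R, A ≤ r ^ e ∧ r ^ e ≤ A' := by
  rcases lt_or_ge R a with h | h
  · exact ⟨1, 1, one_pos, one_pos, fun r hr => absurd (hr.1.trans hr.2) (not_le.2 h)⟩
  have hc : ContinuousOn (fun r : ℝ => r ^ e) (Icc a R) :=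
    continuousOn_id.rpow_const fun r hr => Or.inl (ha.trans_le hr.1).ne'
  obtain ⟨s, hs, hmin⟩ := isCompact_Icc.exists_isMinOn (nonempty_Icc.2 h) hc
  obtain ⟨t, ht, hmax⟩ := isCompact_Icc.exists_isMaxOn (nonempty_Icc.2 h) hc
  exact ⟨s ^ e, t ^ e, Real.rpow_pos_of_pos (ha.trans_le hs.1) _,
    Real.rpow_pos_of_pos (ha.trans_le ht.1) _, fun r hr => ⟨hmin hr, hmax hr⟩⟩

theorem matter_le (hΦ : ∀ a b : ℝ, IntervalIntegrable Φ volume a b)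
    (hΦ0 : ∀ x, 0 ≤ Φ x) (hl : -(1/2) < l) (hL₀ : 0 ≤ L₀) {a R : ℝ} (ha : 0 < a) :
    ∃ C : ℝ, 0 < C ∧ ∀ r ∈ Icc a R, ∀ y : ℝ,
      Gfun l L₀ Φ r y ≤ C * Real.exp ((2 * l + 4) * y) ∧
      Hfun l L₀ Φ r y ≤ C * Real.exp ((2 * l + 4) * y) := by
  obtain ⟨A, A', hA, hA', hpow⟩ := exists_rpow_bounds (R := R) ha (2 * l)
  have hc := cConst_nonneg l
  have hd := dConst_pos hl
  set S := ∫ α in (0:ℝ)..1, Φ α with hS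
  have hS0 : 0 ≤ S := intervalIntegral.integral_nonneg zero_le_one fun x _ => hΦ0 x
  have hw1 : ∀ x ∈ Icc (0:ℝ) 1, (1 - x) ^ 2 ≤ 1 := fun x hx =>
    pow_le_one₀ (by linarith [hx.2]) (by linarith [hx.1])
  refine ⟨2 * π * (cConst l + dConst l) * A' * S + 1, by positivity, fun r hr y => ?_⟩
  have hr0 : 0 < r := ha.trans_le hr.1
  have hB : 0 ≤ 1 + L₀ / r ^ 2 := by positivity
  have hE := (Real.exp_pos (2 * y)).le
  have hpr := (hpow r hr).2
  have hp0 : 0 < r ^ (2 * l) := Real.rpow_pos_of_pos hr0 _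
  have hexp := Real.exp_pos ((2 * l + 4) * y)
  rw [Gfun_eq hΦ hl hL₀, Hfun_eq hΦ hl hL₀]
  constructor
  · have h := cutoffIntegral_le (w := fun α => (1 - α) ^ 2) hΦ hΦ0 (by fun_prop) hw1
      (by linarith : 0 < l + 1 / 2) hE hB
    have h0 := cutoffIntegral_nonneg (w := fun α => (1 - α) ^ 2) (e := l + 1 / 2) hΦ0
      (fun x => sq_nonneg _) (Real.exp (2 * y)) (1 + L₀ / r ^ 2)
    rw [← Real.exp_mul] at h
    calc _ ≤ 2 * π * cConst l * A' * Real.exp (3 * y) *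
          (S * Real.exp (2 * y * (l + 1 / 2))) := by gcongr
      _ = 2 * π * cConst l * A' * S * Real.exp ((2 * l + 4) * y) := by
        rw [show (2 * l + 4) * y = 3 * y + 2 * y * (l + 1 / 2) by ring, Real.exp_add]; ring
      _ ≤ _ := by
        refine mul_le_mul_of_nonneg_right ?_ hexp.le
        have : 0 ≤ 2 * π * dConst l * A' * S := by positivity
        linarith
  · have h := cutoffIntegral_le (w := fun _ => 1) hΦ hΦ0 (by fun_prop) (fun _ _ => le_rfl)
      (by linarith : 0 < l + 3 / 2) hE hB
    have h0 := cutoffIntegral_nonneg (w := fun _ => 1) (e := l + 3 / 2) hΦ0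
      (fun _ => zero_le_one) (Real.exp (2 * y)) (1 + L₀ / r ^ 2)
    rw [← Real.exp_mul] at h
    calc _ ≤ 2 * π * dConst l * A' * Real.exp y *
          (S * Real.exp (2 * y * (l + 3 / 2))) := by gcongr
      _ = 2 * π * dConst l * A' * S * Real.exp ((2 * l + 4) * y) := by
        rw [show (2 * l + 4) * y = y + 2 * y * (l + 3 / 2) by ring, Real.exp_add]; ring
      _ ≤ _ := by
        refine mul_le_mul_of_nonneg_right ?_ hexp.le
        have : 0 ≤ 2 * π * cConst l * A' * S := by positivity
        linarith

theorem le_matter (hΦ : ∀ a b : ℝ, IntervalIntegrable Φ volume a b)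
    (hΦ0 : ∀ x, 0 ≤ Φ x) {α₀ : ℝ} (hα₀ : 0 < α₀) (hΦpos : ∀ x ∈ Ioo 0 α₀, 0 < Φ x)
    (hl : -(1/2) < l) (hL₀ : 0 ≤ L₀) (hc : 0 < cConst l) {a R : ℝ} (ha : 0 < a) :
    ∃ c ystar : ℝ, 0 < c ∧ ∀ r ∈ Icc a R, ∀ y : ℝ, ystar ≤ y →
      c * Real.exp ((2 * l + 4) * y) ≤ Gfun l L₀ Φ r y ∧
      c * Real.exp ((2 * l + 4) * y) ≤ Hfun l L₀ Φ r y := by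
  obtain ⟨A, A', hA, hA', hpow⟩ := exists_rpow_bounds (R := R) ha (2 * l)
  have hd := dConst_pos hl
  set S := ∫ α in (0:ℝ)..(1 / 2), Φ α with hS
  have hS0 : 0 < S := by
    have hβ : 0 < min α₀ (1 / 2) := lt_min hα₀ (by norm_num)
    have h1 : 0 < ∫ α in (0:ℝ)..(min α₀ (1 / 2)), Φ α :=
      intervalIntegral.intervalIntegral_pos_of_pos_on (hΦ _ _)
        (fun x hx => hΦpos x ⟨hx.1, hx.2.trans_le (min_le_left _ _)⟩) hβ
    have h2 : 0 ≤ ∫ α in (min α₀ (1 / 2))..(1 / 2), Φ α :=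
      intervalIntegral.integral_nonneg (min_le_right _ _) fun x _ => hΦ0 x
    rw [hS, ← intervalIntegral.integral_add_adjacent_intervals (hΦ 0 (min α₀ (1 / 2))) (hΦ _ _)]
    linarith
  set q := (1 / 8 : ℝ) ^ (l + 3 / 2) with hq
  have hq0 : 0 < q := Real.rpow_pos_of_pos (by norm_num) _
  refine ⟨2 * π * min (cConst l) (dConst l) * A * S * q,
    Real.log (8 * (1 + L₀ / a ^ 2)) / 2, by positivity, fun r hr y hy => ?_⟩
  have hr0 : 0 < r := ha.trans_le hr.1
  have hB : 0 ≤ 1 + L₀ / r ^ 2 := by positivity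
  have hE := (Real.exp_pos (2 * y)).le
  have hpr := (hpow r hr).1
  have h8 : 8 * (1 + L₀ / r ^ 2) ≤ Real.exp (2 * y) := by
    have h1 : 8 * (1 + L₀ / r ^ 2) ≤ 8 * (1 + L₀ / a ^ 2) := by
      have := hr.1
      gcongr
    refine h1.trans ?_
    rw [← Real.log_le_iff_le_exp (by positivity)]
    linarith
  have h := le_cutoffIntegral hΦ hΦ0 (by linarith : 0 < l + 3 / 2) hE h8
  rw [show Real.exp (2 * y) / 8 = Real.exp (2 * y) * (1 / 8) by ring,
    Real.mul_rpow hE (by norm_num), ← Real.exp_mul] at h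
  have h' := cutoffIntegral_succ_le hΦ hΦ0 (by linarith : 0 < l + 1 / 2) hE hB
  rw [show l + 1 / 2 + 1 = l + 3 / 2 by ring] at h'
  rw [Gfun_eq hΦ hl hL₀, Hfun_eq hΦ hl hL₀]
  constructor
  · calc _ ≤ 2 * π * cConst l * A * S * q * Real.exp ((2 * l + 4) * y) := by
          gcongr; exact min_le_left _ _
      _ = 2 * π * cConst l * A * Real.exp y * (S * (Real.exp (2 * y * (l + 3 / 2)) * q)) := by
        rw [show (2 * l + 4) * y = y + 2 * y * (l + 3 / 2) by ring, Real.exp_add]; ring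
      _ ≤ 2 * π * cConst l * r ^ (2 * l) * Real.exp y * (Real.exp (2 * y) *
          cutoffIntegral Φ (fun α => (1 - α) ^ 2) (l + 1 / 2) (Real.exp (2 * y))
            (1 + L₀ / r ^ 2)) := by
        have := h.trans h'
        gcongr
      _ = _ := by
        rw [show 3 * y = y + 2 * y by ring, Real.exp_add]; ring
  · calc _ ≤ 2 * π * dConst l * A * S * q * Real.exp ((2 * l + 4) * y) := by
          gcongr; exact min_le_right _ _
      _ = 2 * π * dConst l * A * Real.exp y * (S * (Real.exp (2 * y * (l + 3 / 2)) * q)) := by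
        rw [show (2 * l + 4) * y = y + 2 * y * (l + 3 / 2) by ring, Real.exp_add]; ring
      _ ≤ _ := by gcongr

theorem Gfun_pos (hΦ : ∀ a b : ℝ, IntervalIntegrable Φ volume a b)
    (hΦ0 : ∀ x, 0 ≤ Φ x) {α₀ : ℝ} (hα₀ : 0 < α₀) (hΦpos : ∀ x ∈ Ioo 0 α₀, 0 < Φ x)
    (hl : -(1/2) < l) (hL₀ : 0 ≤ L₀) (hc : 0 < cConst l) {r y : ℝ} (hr : 0 < r)
    (h : 1 + L₀ / r ^ 2 < Real.exp (2 * y)) : 0 < Gfun l L₀ Φ r y := by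
  rw [Gfun_eq hΦ hl hL₀]
  have := Real.rpow_pos_of_pos hr (2 * l)
  refine mul_pos (by positivity) (cutoffIntegral_pos hΦ hΦ0 hα₀ hΦpos (by fun_prop)
    (fun x => sq_nonneg _) (fun x hx => ?_) (by linarith) (by positivity) h)
  have : 0 < 1 - x := by linarith
  positivity

theorem Hfun_lipschitz (hΦ : ∀ a b : ℝ, IntervalIntegrable Φ volume a b)
    (hΦ0 : ∀ x, 0 ≤ Φ x) (hl : -(1/2) < l) (hL₀ : 0 ≤ L₀) {a R : ℝ} (ha : 0 < a) (Y : ℝ) :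
    ∃ K : ℝ, 0 ≤ K ∧ ∀ r ∈ Icc a R, ∀ r' ∈ Icc a R, ∀ y ∈ Icc (-Y) Y, ∀ y' ∈ Icc (-Y) Y,
      |Hfun l L₀ Φ r y - Hfun l L₀ Φ r' y'| ≤ K * (|r - r'| + |y - y'|) := by
  have hd := dConst_pos hl
  obtain ⟨A, A', hA, hA', hpow⟩ := exists_rpow_bounds (R := R) ha (2 * l)
  obtain ⟨K₁, hK₁, h₁⟩ := exists_lipschitz_Icc (f := fun r : ℝ => r ^ (2 * l))
    (f' := fun r => 2 * l * r ^ (2 * l - 1)) (a := a) (b := R)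
    (fun x hx => Real.hasDerivAt_rpow_const (Or.inl (ha.trans_le hx.1).ne'))
    (continuousOn_const.mul (continuousOn_id.rpow_const
      fun r hr => Or.inl (ha.trans_le hr.1).ne'))
  obtain ⟨K₂, hK₂, h₂⟩ := exists_lipschitz_Icc (f := Real.exp) (f' := Real.exp) (a := -Y) (b := Y)
    (fun x _ => Real.hasDerivAt_exp x) Real.continuous_exp.continuousOn
  obtain ⟨K₃, hK₃, h₃⟩ := exists_lipschitz_Icc (f := fun y => Real.exp (2 * y))
    (f' := fun y => Real.exp (2 * y) * 2) (a := -Y) (b := Y)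
    (fun x _ => by simpa using ((hasDerivAt_id x).const_mul 2).exp) (by fun_prop)
  obtain ⟨K₄, hK₄, h₄⟩ := exists_lipschitz_Icc (f := fun r : ℝ => 1 + L₀ / r ^ 2)
    (f' := fun r => -(2 * L₀) / r ^ 3) (a := a) (b := R)
    (fun x hx => by
      have hx0 : x ≠ 0 := (ha.trans_le hx.1).ne'
      have := ((hasDerivAt_const x L₀).div (hasDerivAt_pow 2 x) (pow_ne_zero 2 hx0)).const_add 1
      refine this.congr_deriv ?_
      field_simp
      simp
      ring)
    (continuousOn_const.div (by fun_prop) fun r hr => pow_ne_zero 3 (ha.trans_le hr.1).ne')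
  set S := ∫ α in (0:ℝ)..1, Φ α with hS
  have hS0 : 0 ≤ S := intervalIntegral.integral_nonneg zero_le_one fun x _ => hΦ0 x
  set E := Real.exp (2 * Y) with hE
  have hE0 : 0 ≤ E := (Real.exp_pos _).le
  set q := (l + 3 / 2) * E ^ (l + 3 / 2 - 1) with hq
  have hq0 : 0 ≤ q := mul_nonneg (by linarith) (Real.rpow_nonneg hE0 _)
  have hEe : 0 ≤ E ^ (l + 3 / 2) := Real.rpow_nonneg hE0 _
  refine ⟨2 * π * dConst l * ((A' * Real.exp Y) * (S * (q * (K₃ + K₄))) +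
    (S * E ^ (l + 3 / 2)) * (A' * K₂ + Real.exp Y * K₁)), by positivity,
    fun r hr r' hr' y hy y' hy' => ?_⟩
  set D := |r - r'| + |y - y'| with hD
  have hr0 : 0 < r := ha.trans_le hr.1
  have hr0' : 0 < r' := ha.trans_le hr'.1
  have hDr : |r - r'| ≤ D := le_add_of_nonneg_right (abs_nonneg _)
  have hDy : |y - y'| ≤ D := le_add_of_nonneg_left (abs_nonneg _)
  have hEy : ∀ z ∈ Icc (-Y) Y, Real.exp (2 * z) ≤ E := fun z hz =>
    Real.exp_le_exp.2 (by linarith [hz.2])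
  have e3 : |cutoffIntegral Φ (fun _ => 1) (l + 3 / 2) (Real.exp (2 * y)) (1 + L₀ / r ^ 2) -
      cutoffIntegral Φ (fun _ => 1) (l + 3 / 2) (Real.exp (2 * y')) (1 + L₀ / r' ^ 2)| ≤
      S * (q * (K₃ + K₄)) * D := by
    refine (cutoffIntegral_lipschitz hΦ hΦ0 (by linarith) (Real.exp_pos _).le (hEy y hy)
      (hEy y' hy') (by positivity) (by positivity)).trans ?_
    rw [← hq, show S * (q * (K₃ + K₄)) * D = S * (q * ((K₃ + K₄) * D)) by ring]
    have t1 := (h₃ y hy y' hy').trans (mul_le_mul_of_nonneg_left hDy hK₃)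
    have t2 := (h₄ r hr r' hr').trans (mul_le_mul_of_nonneg_left hDr hK₄)
    gcongr
    linarith
  have e1 := (h₁ r hr r' hr').trans (mul_le_mul_of_nonneg_left hDr hK₁)
  have e2 := (h₂ y hy y' hy').trans (mul_le_mul_of_nonneg_left hDy hK₂)
  have b1 : |r ^ (2 * l)| ≤ A' := by
    rw [abs_of_nonneg (Real.rpow_nonneg hr0.le _)]; exact (hpow r hr).2
  have b2 : ∀ z ∈ Icc (-Y) Y, |Real.exp z| ≤ Real.exp Y := fun z hz => by
    rw [abs_of_pos (Real.exp_pos _)]; exact Real.exp_le_exp.2 hz.2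
  have b3 : |cutoffIntegral Φ (fun _ => 1) (l + 3 / 2) (Real.exp (2 * y')) (1 + L₀ / r' ^ 2)| ≤
      S * E ^ (l + 3 / 2) := by
    rw [abs_of_nonneg (cutoffIntegral_nonneg hΦ0 (fun _ => zero_le_one) _ _)]
    refine (cutoffIntegral_le (w := fun _ => 1) hΦ hΦ0 (by fun_prop) (fun _ _ => le_rfl)
      (by linarith) (Real.exp_pos _).le (by positivity)).trans ?_
    have := Real.rpow_le_rpow (Real.exp_pos _).le (hEy y' hy') (by linarith : 0 ≤ l + 3 / 2)
    gcongr
  have e12 := abs_mul_sub_mul_le b1 (b2 y' hy') e1 e2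
  have b12 : |r ^ (2 * l) * Real.exp y| ≤ A' * Real.exp Y := by
    rw [abs_mul]
    exact mul_le_mul b1 (b2 y hy) (abs_nonneg _) hA'.le
  have e123 := abs_mul_sub_mul_le b12 b3 e12 e3
  rw [Hfun_eq hΦ hl hL₀, Hfun_eq hΦ hl hL₀]
  have : ∀ u v w u' v' w' : ℝ, 2 * π * dConst l * u * v * w - 2 * π * dConst l * u' * v' * w' =
      2 * π * dConst l * (u * v * w - u' * v' * w') := fun u v w u' v' w' => by ring
  rw [this, abs_mul, abs_of_pos (by positivity : 0 < 2 * π * dConst l), mul_assoc (2 * π * dConst l)]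
  exact mul_le_mul_of_nonneg_left e123 (by positivity)

end Matter

/-- The reduced shell equations on `[a, b]`, with two-sided bounds on density and pressure. -/
structure ShellData (M a b k C₁ c₁ ystar δ : ℝ) (χ y m ρ p : ℝ → ℝ) : Prop where
  hm : ∀ r ∈ Icc a b, HasDerivAt m (4 * π * r ^ 2 * ρ r) r
  hma : m a = 0
  hv : ∀ r ∈ Icc a b, 0 < r - 2 * M - 2 * m r
  hy : ∀ r ∈ Icc a b, HasDerivAt y
    (-((M + m r) / r + 4 * π * r ^ 2 * p r) / (r - 2 * M - 2 * m r)) r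
  hρ0 : ∀ r ∈ Icc a b, 0 ≤ ρ r
  hp0 : ∀ r ∈ Icc a b, 0 ≤ p r
  hρ : ∀ r ∈ Icc a b, ρ r ≤ C₁ * (δ * χ (r - a) * Real.exp (k * y r))
  hp : ∀ r ∈ Icc a b, p r ≤ C₁ * (δ * χ (r - a) * Real.exp (k * y r))
  hρl : ∀ r ∈ Icc a b, ystar ≤ y r → c₁ * (δ * χ (r - a) * Real.exp (k * y r)) ≤ ρ r
  hpl : ∀ r ∈ Icc a b, ystar ≤ y r → c₁ * (δ * χ (r - a) * Real.exp (k * y r)) ≤ p r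

theorem monotoneOn_Icc_of_hasDerivAt {f f' : ℝ → ℝ} {a b : ℝ}
    (hf : ∀ x ∈ Icc a b, HasDerivAt f (f' x) x) (hf' : ∀ x ∈ Ioo a b, 0 ≤ f' x) :
    MonotoneOn f (Icc a b) := by
  refine monotoneOn_of_deriv_nonneg (convex_Icc a b)
    (fun x hx => (hf x hx).continuousAt.continuousWithinAt) ?_ ?_
  · rw [interior_Icc]
    exact fun x hx => (hf x (Ioo_subset_Icc_self hx)).differentiableAt.differentiableWithinAt
  · rw [interior_Icc]
    intro x hx
    rw [(hf x (Ioo_subset_Icc_self hx)).deriv]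
    exact hf' x hx

namespace ShellData

variable {M a b k C₁ c₁ ystar δ : ℝ} {χ y m ρ p : ℝ → ℝ}

theorem mass_nonneg (S : ShellData M a b k C₁ c₁ ystar δ χ y m ρ p) {r : ℝ} (hr : r ∈ Icc a b) :
    0 ≤ m r := by
  have h := monotoneOn_Icc_of_hasDerivAt S.hm fun x hx => by
    have := S.hρ0 x (Ioo_subset_Icc_self hx)
    positivity
  rw [← S.hma]
  exact h (left_mem_Icc.2 (hr.1.trans hr.2)) hr hr.1

theorem antitoneOn (S : ShellData M a b k C₁ c₁ ystar δ χ y m ρ p) (hM : 0 < M) (ha : 0 < a) :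
    AntitoneOn y (Icc a b) := by
  have h := monotoneOn_Icc_of_hasDerivAt (f := fun r => -y r) (fun r hr => (S.hy r hr).neg)
    fun r hr => by
      have hr' := Ioo_subset_Icc_self hr
      have h1 := S.mass_nonneg hr'
      have h2 := S.hp0 r hr'
      have h3 := S.hv r hr'
      have h4 : 0 < r := ha.trans hr.1
      rw [neg_div, neg_neg]
      positivity
  exact fun r hr s hs hrs => neg_le_neg_iff.1 (h hr hs hrs)

theorem hasDerivAt_radius (S : ShellData M a b k C₁ c₁ ystar δ χ y m ρ p) {r : ℝ}
    (hr : r ∈ Icc a b) :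
    HasDerivAt (fun r => r - 2 * M - 2 * m r) (1 - 2 * (4 * π * r ^ 2 * ρ r)) r :=
  ((hasDerivAt_id r).sub_const (2 * M)).sub ((S.hm r hr).const_mul 2)

/-- In a region of low density `v ^ β * exp y` grows. -/
theorem monotoneOn_of_low_density (S : ShellData M a b k C₁ c₁ ystar δ χ y m ρ p)
    (ha : 0 < a) (hC₁ : 0 < C₁) {β : ℝ} (hβ : 2 ≤ β) {r₁ : ℝ} (hr₁ : a ≤ r₁)
    (hlow : ∀ r ∈ Ioo r₁ b, δ * χ (r - a) * Real.exp (k * y r) ≤ 1 / (16 * π * b ^ 2 * C₁)) :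
    MonotoneOn (fun r => y r + β * Real.log (r - 2 * M - 2 * m r)) (Icc r₁ b) ∧
      MonotoneOn (fun r => r - 2 * M - 2 * m r) (Icc r₁ b) := by
  have sub : ∀ r ∈ Icc r₁ b, r ∈ Icc a b := fun r hr => ⟨hr₁.trans hr.1, hr.2⟩
  have small : ∀ r ∈ Ioo r₁ b, ∀ z ≤ C₁ * (δ * χ (r - a) * Real.exp (k * y r)),
      4 * π * r ^ 2 * z ≤ 1 / 4 := by
    intro r hr z hz
    have hr0 : 0 < r := ha.trans (hr₁.trans_lt hr.1)
    have hb0 : 0 < b := hr0.trans hr.2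
    have h1 : z ≤ C₁ * (1 / (16 * π * b ^ 2 * C₁)) :=
      hz.trans (mul_le_mul_of_nonneg_left (hlow r hr) hC₁.le)
    have h2 : r ^ 2 ≤ b ^ 2 := pow_le_pow_left₀ hr0.le hr.2.le 2
    calc 4 * π * r ^ 2 * z ≤ 4 * π * r ^ 2 * (C₁ * (1 / (16 * π * b ^ 2 * C₁))) := by gcongr
      _ ≤ 4 * π * b ^ 2 * (C₁ * (1 / (16 * π * b ^ 2 * C₁))) := by gcongr
      _ = 1 / 4 := by field_simp; norm_num
  constructor
  · refine monotoneOn_Icc_of_hasDerivAt (fun r hr => (S.hy r (sub r hr)).add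
      (((S.hasDerivAt_radius (sub r hr)).log (S.hv r (sub r hr)).ne').const_mul β)) fun r hr => ?_
    have hr' := sub r (Ioo_subset_Icc_self hr)
    have hr0 : 0 < r := ha.trans (hr₁.trans_lt hr.1)
    have hv := S.hv r hr'
    have s1 := small r hr _ (S.hρ r hr')
    have s2 := small r hr _ (S.hp r hr')
    have h3 : (M + m r) / r ≤ 1 / 2 := by
      rw [div_le_iff₀ hr0]; linarith
    rw [mul_div_assoc', ← add_div]
    refine div_nonneg ?_ hv.le
    nlinarith
  · refine monotoneOn_Icc_of_hasDerivAt (fun r hr => S.hasDerivAt_radius (sub r hr)) fun r hr => ?_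
    have s1 := small r hr _ (S.hρ r (sub r (Ioo_subset_Icc_self hr)))
    linarith

/-- In the relativistic region `v * exp (-γ y)` grows. -/
theorem monotoneOn_of_relativistic (S : ShellData M a b k C₁ c₁ ystar δ χ y m ρ p)
    (hM : 0 < M) (ha : 0 < a) (hδ : 0 ≤ δ) (hχ : ∀ x, 0 ≤ χ x)
    {γ : ℝ} (hγ0 : 0 ≤ γ) (hγ : 2 * C₁ ≤ γ * c₁) {r₁ : ℝ} (hr₁ : r₁ ≤ b)
    (hrel : ∀ r ∈ Icc a r₁, ystar ≤ y r) :
    MonotoneOn (fun r => Real.log (r - 2 * M - 2 * m r) - γ * y r) (Icc a r₁) := by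
  have sub : ∀ r ∈ Icc a r₁, r ∈ Icc a b := fun r hr => ⟨hr.1, hr.2.trans hr₁⟩
  refine monotoneOn_Icc_of_hasDerivAt (fun r hr =>
    ((S.hasDerivAt_radius (sub r hr)).log (S.hv r (sub r hr)).ne').sub
      ((S.hy r (sub r hr)).const_mul γ)) fun r hr => ?_
  have hrI := Ioo_subset_Icc_self hr
  have hr' := sub r hrI
  have hr0 : 0 < r := ha.trans hr.1
  have hv := S.hv r hr'
  have hm := S.mass_nonneg hr'
  set q := δ * χ (r - a) * Real.exp (k * y r) with hq
  have hq0 : 0 ≤ q := mul_nonneg (mul_nonneg hδ (hχ _)) (Real.exp_pos _).le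
  have h1 : 2 * ρ r ≤ γ * p r := by
    have e1 := S.hρ r hr'
    have e2 := mul_le_mul_of_nonneg_left (S.hpl r hr' (hrel r hrI)) hγ0
    have e3 := mul_le_mul_of_nonneg_right hγ hq0
    rw [← hq] at e1 e2
    linarith
  rw [mul_div_assoc', ← sub_div]
  refine div_nonneg ?_ hv.le
  have h2 : 0 ≤ γ * ((M + m r) / r) := by positivity
  have h3 : 4 * π * r ^ 2 * (2 * ρ r) ≤ 4 * π * r ^ 2 * (γ * p r) := by gcongr
  linarith

/-- The mass inside radius `h` is bounded below by the value of `y` at `h`. -/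
theorem mass_lower_bound (S : ShellData M a b k C₁ c₁ ystar δ χ y m ρ p)
    (hM : 0 < M) (ha : 0 < a) (hk : 0 < k) (hδ : 0 ≤ δ) (hc₁ : 0 < c₁) (hχ : ∀ x, 0 ≤ χ x)
    (hχc : Continuous χ) {h : ℝ} (hh : h ∈ Icc a b) (hrel : ystar ≤ y h) :
    4 * π * a ^ 2 * c₁ * δ * Real.exp (k * y h) * (∫ s in (0:ℝ)..(h - a), χ s) ≤ m h := by
  have sub : ∀ r ∈ Icc a h, r ∈ Icc a b := fun r hr => ⟨hr.1, hr.2.trans hh.2⟩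
  have hX : ∀ r, HasDerivAt (fun r => ∫ s in (0:ℝ)..(r - a), χ s) (χ (r - a)) r := fun r => by
    have h1 : HasDerivAt (fun x => ∫ s in (0:ℝ)..x, χ s) (χ (r - a)) (r - a) :=
      intervalIntegral.integral_hasDerivAt_right (hχc.intervalIntegrable _ _)
        (hχc.stronglyMeasurableAtFilter _ _) hχc.continuousAt
    exact h1.comp_sub_const r a
  have hmono := monotoneOn_Icc_of_hasDerivAt (fun r hr => (S.hm r (sub r hr)).sub
    ((hX r).const_mul (4 * π * a ^ 2 * c₁ * δ * Real.exp (k * y h)))) fun r hr => by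
      have hr' := sub r (Ioo_subset_Icc_self hr)
      have hyr : y h ≤ y r := S.antitoneOn hM ha hr' hh hr.2.le
      have h1 := S.hρl r hr' (hrel.trans hyr)
      have h2 : a ^ 2 ≤ r ^ 2 := pow_le_pow_left₀ ha.le hr.1.le 2
      have h3 : Real.exp (k * y h) ≤ Real.exp (k * y r) :=
        Real.exp_le_exp.2 (mul_le_mul_of_nonneg_left hyr hk.le)
      have hχr := hχ (r - a)
      rw [sub_nonneg]
      calc 4 * π * a ^ 2 * c₁ * δ * Real.exp (k * y h) * χ (r - a)
          ≤ 4 * π * r ^ 2 * c₁ * δ * Real.exp (k * y r) * χ (r - a) := by gcongr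
        _ = 4 * π * r ^ 2 * (c₁ * (δ * χ (r - a) * Real.exp (k * y r))) := by ring
        _ ≤ _ := by gcongr
  have := hmono (left_mem_Icc.2 hh.1) (right_mem_Icc.2 hh.1) hh.1
  simp only [Pi.sub_apply] at this
  rw [S.hma, sub_self, intervalIntegral.integral_same] at this
  linarith

end ShellData

/-- Splitting the mass of a flat profile in half. -/
theorem exists_half_primitive {χ : ℝ → ℝ} (hχc : Continuous χ) (hχ : ∀ x, 0 ≤ χ x)
    {N : ℕ} (hN : N ≠ 0) {D x₁ : ℝ} (hD : 1 ≤ D) (hx₁ : 0 ≤ x₁)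
    (hflat : ∀ x ≤ x₁, χ x ^ (N + 1) ≤ D * (∫ s in (0:ℝ)..x, χ s) ^ N)
    (hpos : 0 < χ x₁) :
    ∃ t h : ℝ, 0 < t ∧ h ∈ Icc 0 x₁ ∧ 2 * (∫ s in (0:ℝ)..h, χ s) = t ^ (N + 1) ∧
      χ x₁ ≤ D * t ^ N ∧ t ≤ 2 * D * (x₁ - h) := by
  set X : ℝ → ℝ := fun x => ∫ s in (0:ℝ)..x, χ s with hX
  have hXc : Continuous X := intervalIntegral.continuous_primitive
    (fun a b => hχc.intervalIntegrable a b) 0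
  have hX0 : X 0 = 0 := intervalIntegral.integral_same
  have hXsub : ∀ x z, X z - X x = ∫ s in x..z, χ s := fun x z =>
    intervalIntegral.integral_interval_sub_left
      (hχc.intervalIntegrable _ _) (hχc.intervalIntegrable _ _)
  have hXmono : ∀ x z, x ≤ z → X x ≤ X z := fun x z hxz => by
    have h2 : 0 ≤ ∫ s in x..z, χ s := intervalIntegral.integral_nonneg hxz fun s _ => hχ s
    linarith [hXsub x z]
  have hXpos : 0 < X x₁ := by
    refine lt_of_le_of_ne (hX0 ▸ hXmono 0 x₁ hx₁) fun h => ?_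
    have h1 : χ x₁ ^ (N + 1) ≤ D * X x₁ ^ N := hflat x₁ le_rfl
    rw [← h, zero_pow hN, mul_zero] at h1
    exact absurd h1 (not_le.2 (pow_pos hpos _))
  obtain ⟨t, ht, htX⟩ : ∃ t : ℝ, 0 < t ∧ t ^ (N + 1) = X x₁ :=
    ⟨X x₁ ^ (((N + 1 : ℕ) : ℝ)⁻¹), Real.rpow_pos_of_pos hXpos _,
      Real.rpow_inv_natCast_pow hXpos.le (Nat.succ_ne_zero N)⟩
  have hle : ∀ x, 0 ≤ x → x ≤ x₁ → χ x ≤ D * t ^ N := fun x hx0 hx => by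
    have hXx : 0 ≤ X x := hX0 ▸ hXmono 0 x hx0
    refine (pow_le_pow_iff_left₀ (hχ x) (by positivity) (Nat.succ_ne_zero N)).1 ?_
    calc χ x ^ (N + 1) ≤ D * X x ^ N := hflat x hx
      _ ≤ D ^ (N + 1) * X x₁ ^ N := by
        gcongr
        · exact le_self_pow₀ hD (Nat.succ_ne_zero N)
        · exact hXmono x x₁ hx
      _ = (D * t ^ N) ^ (N + 1) := by rw [← htX]; ring
  obtain ⟨h, hh, hXh⟩ : ∃ h ∈ Icc 0 x₁, X h = X x₁ / 2 :=
    intermediate_value_Icc hx₁ hXc.continuousOn ⟨by rw [hX0]; positivity, by linarith⟩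
  refine ⟨t, h, ht, hh, ?_, hle x₁ hx₁ le_rfl, ?_⟩
  · rw [htX]
    change 2 * X h = _
    linarith
  · have h1 : X x₁ - X h ≤ ∫ _ in h..x₁, D * t ^ N := by
      rw [hXsub]
      exact intervalIntegral.integral_mono_on hh.2 (hχc.intervalIntegrable _ _)
        intervalIntegrable_const fun s hs => hle s (hh.1.trans hs.1) hs.2
    rw [intervalIntegral.integral_const, smul_eq_mul, hXh, ← htX] at h1
    have h2 : t ^ N * t ≤ t ^ N * (2 * D * (x₁ - h)) := by
      rw [← pow_succ]
      linarith
    exact le_of_mul_le_mul_left h2 (by positivity)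

namespace ShellData

variable {M a b k C₁ c₁ ystar δ : ℝ} {χ y m ρ p : ℝ → ℝ}

theorem radius_le (S : ShellData M a b k C₁ c₁ ystar δ χ y m ρ p) (hM : 0 < M)
    {r : ℝ} (hr : r ∈ Icc a b) : r - 2 * M - 2 * m r ≤ b := by
  linarith [S.mass_nonneg hr, hr.2]

/-- Quantitative steepness of `y` in the relativistic region. -/
theorem steep_of_relativistic (S : ShellData M a b k C₁ c₁ ystar δ χ y m ρ p)
    (hM : 0 < M) (ha : 0 < a) (hδ : 0 ≤ δ) (hχ : ∀ x, 0 ≤ χ x)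
    {γ : ℝ} (hγ0 : 0 ≤ γ) (hγ : 2 * C₁ ≤ γ * c₁) {r₁ h : ℝ} (hr₁ : r₁ ≤ b) (hh : h ∈ Icc a r₁)
    (hrel : ∀ r ∈ Icc a r₁, ystar ≤ y r) :
    M * (r₁ - h) ≤
      b * ((r₁ - 2 * M - 2 * m r₁) * Real.exp (γ * (y h - y r₁))) * (y h - y r₁) := by
  set V := (r₁ - 2 * M - 2 * m r₁) * Real.exp (γ * (y h - y r₁)) with hVdef
  have hr₁I : r₁ ∈ Icc a r₁ := right_mem_Icc.2 (hh.1.trans hh.2)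
  have hr₁I' : r₁ ∈ Icc a b := ⟨hr₁I.1, hr₁⟩
  have hb : 0 < b := ha.trans_le (hr₁I'.1.trans hr₁)
  have hV : 0 < V := mul_pos (S.hv r₁ hr₁I') (Real.exp_pos _)
  have sub : ∀ r ∈ Icc h r₁, r ∈ Icc a b := fun r hr => ⟨hh.1.trans hr.1, hr.2.trans hr₁⟩
  have hvV : ∀ r ∈ Icc h r₁, r - 2 * M - 2 * m r ≤ V := fun r hr => by
    have h1 := S.monotoneOn_of_relativistic hM ha hδ hχ hγ0 hγ hr₁ hrel
      (⟨hh.1.trans hr.1, hr.2⟩ : r ∈ Icc a r₁) hr₁I hr.2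
    have h2 := S.antitoneOn hM ha ⟨hh.1, hh.2.trans hr₁⟩ (sub r hr) hr.1
    simp only at h1
    rw [← Real.log_le_log_iff (S.hv r (sub r hr)) hV, hVdef,
      Real.log_mul (S.hv r₁ hr₁I').ne' (Real.exp_pos _).ne', Real.log_exp]
    nlinarith
  have hmono := monotoneOn_Icc_of_hasDerivAt (fun r hr => ((S.hy r (sub r hr)).neg).sub
    ((hasDerivAt_id r).const_mul (M / (b * V)))) fun r hr => by
      have hrI := Ioo_subset_Icc_self hr
      have hr' := sub r hrI
      have hr0 : 0 < r := ha.trans_le hr'.1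
      have h1 := S.mass_nonneg hr'
      have h2 := S.hp0 r hr'
      have h3 := S.hv r hr'
      rw [neg_div, neg_neg, sub_nonneg, mul_one, ← div_div]
      have h4 : M / b ≤ (M + m r) / r := by
        have := hr'.2
        gcongr
        linarith
      have h5 : 0 ≤ 4 * π * r ^ 2 * p r := by positivity
      have := hvV r hrI
      gcongr
      linarith
  have := hmono (left_mem_Icc.2 hh.2) (right_mem_Icc.2 hh.2) hh.2
  simp only [Pi.sub_apply, Pi.neg_apply, id] at this
  have h6 : M / (b * V) * (r₁ - h) ≤ y h - y r₁ := by linarith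
  rw [div_mul_eq_mul_div, div_le_iff₀ (by positivity)] at h6
  linarith

end ShellData

/-- The scaling contradiction that excludes relativistic shells of small amplitude. -/
theorem amplitude_lower_bound {t v W θ δ D P c C : ℝ} {n n' : ℕ} (ht : 0 < t) (hv : 0 < v)
    (hW : 0 < W) (hC : 0 < C) (hc : 0 < c)
    (h₁ : θ * v ^ n' ≤ δ * D * P * t ^ ((n + 2) * n')) (h₂ : W * t ≤ C)
    (h₃ : c * t ≤ v * W ^ (n + 1)) (hθ : 0 ≤ θ) :
    θ * c ^ n' ≤ δ * (D * P * C ^ ((n + 1) * n')) := by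
  have h4 : c * t ^ (n + 2) ≤ v * C ^ (n + 1) := by
    calc c * t ^ (n + 2) = c * t * t ^ (n + 1) := by ring
      _ ≤ v * W ^ (n + 1) * t ^ (n + 1) := by gcongr
      _ = v * (W * t) ^ (n + 1) := by ring
      _ ≤ v * C ^ (n + 1) := by gcongr
  have h5 : c ^ n' * t ^ ((n + 2) * n') ≤ v ^ n' * C ^ ((n + 1) * n') := by
    rw [pow_mul, pow_mul, ← mul_pow, ← mul_pow]
    exact pow_le_pow_left₀ (by positivity) h4 _
  refine le_of_mul_le_mul_right (a := t ^ ((n + 2) * n')) ?_ (by positivity)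
  calc θ * c ^ n' * t ^ ((n + 2) * n') = θ * (c ^ n' * t ^ ((n + 2) * n')) := by ring
    _ ≤ θ * (v ^ n' * C ^ ((n + 1) * n')) := by gcongr
    _ = θ * v ^ n' * C ^ ((n + 1) * n') := by ring
    _ ≤ δ * D * P * t ^ ((n + 2) * n') * C ^ ((n + 1) * n') := by gcongr
    _ = _ := by ring

namespace ShellData

variable {M a b k C₁ c₁ ystar : ℝ} {χ : ℝ → ℝ}

/-- If the density is not small somewhere, then the amplitude is bounded below. -/
theorem amplitude_lower_bound_of_dense {δ θ D y₀ r₁ : ℝ} {y m ρ p : ℝ → ℝ} {n n' : ℕ}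
    (S : ShellData M a b k C₁ c₁ ystar δ χ y m ρ p)
    (hχc : Continuous χ) (hχ : ∀ x, 0 ≤ χ x) (hM : 0 < M) (ha : 0 < a)
    (hk : 0 < k) (hC₁ : 0 < C₁) (hc₁ : 0 < c₁) (hn : 2 * C₁ ≤ n * k * c₁)
    (hn'0 : n' ≠ 0) (hn' : 2 * k ≤ n') (hD : 1 ≤ D)
    (hflat : ∀ x ≤ b - a, χ x ^ ((n + 2) * n' + 1) ≤
      D * (∫ s in (0:ℝ)..x, χ s) ^ ((n + 2) * n'))
    (hδ : 0 < δ) (hy₀ : y b = y₀) (hθ : 0 < θ) (hθ' : θ ≤ 1 / (16 * π * b ^ 2 * C₁))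
    (hr₁ : r₁ ∈ Icc a b) (hdense : θ ≤ δ * χ (r₁ - a) * Real.exp (k * y r₁))
    (hlow : ∀ r ∈ Ioo r₁ b, δ * χ (r - a) * Real.exp (k * y r) ≤ θ) (hrel : ystar ≤ y r₁) :
    θ * (k * M / (2 * b * D)) ^ n' ≤
      δ * (D * (Real.exp (k * y₀) * b ^ n') *
        (D * b / (4 * π * a ^ 2 * c₁) / θ) ^ ((n + 1) * n')) := by
  have hb : 0 < b := ha.trans_le (hr₁.1.trans hr₁.2)
  have hrel' : ∀ r ∈ Icc a r₁, ystar ≤ y r := fun r hr =>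
    hrel.trans (S.antitoneOn hM ha ⟨hr.1, hr.2.trans hr₁.2⟩ hr₁ hr.2)
  have hχpos : 0 < χ (r₁ - a) := by
    refine lt_of_le_of_ne (hχ _) fun h => ?_
    rw [← h, mul_zero, zero_mul] at hdense
    linarith
  obtain ⟨t, x, ht, hx, hXx, hχt, htx⟩ := exists_half_primitive hχc hχ (N := (n + 2) * n')
    (by positivity) hD (sub_nonneg.2 hr₁.1)
    (fun z hz => hflat z (hz.trans (sub_le_sub_right hr₁.2 a))) hχpos
  set h := a + x with hh
  have hhI : h ∈ Icc a r₁ := ⟨by linarith [hx.1], by linarith [hx.2]⟩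
  have hhI' : h ∈ Icc a b := ⟨hhI.1, hhI.2.trans hr₁.2⟩
  have hv := S.hv r₁ hr₁
  set v := r₁ - 2 * M - 2 * m r₁ with hvdef
  have hyh : y r₁ ≤ y h := S.antitoneOn hM ha hhI' hr₁ hhI.2
  have hdense' : θ ≤ δ * (D * t ^ ((n + 2) * n')) * Real.exp (k * y r₁) := by
    refine hdense.trans ?_
    gcongr
  refine amplitude_lower_bound (v := v) (W := Real.exp (k * (y h - y r₁))) ht hv (Real.exp_pos _)
    (by positivity) (by positivity) ?_ ?_ ?_ hθ.le
  · have hβ : 2 ≤ (n' : ℝ) / k := by rw [le_div_iff₀ hk]; exact hn'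
    have h1 := (S.monotoneOn_of_low_density ha hC₁ hβ hr₁.1
      fun r hr => (hlow r hr).trans hθ').1 (left_mem_Icc.2 hr₁.2) (right_mem_Icc.2 hr₁.2) hr₁.2
    simp only [hy₀] at h1
    rw [← hvdef] at h1
    have hbI : b ∈ Icc a b := right_mem_Icc.2 (hr₁.1.trans hr₁.2)
    have h2 : Real.log (b - 2 * M - 2 * m b) ≤ Real.log b :=
      Real.log_le_log (S.hv b hbI) (S.radius_le hM hbI)
    have h3 : k * y r₁ + n' * Real.log v ≤ k * y₀ + n' * Real.log b := by
      have h4 : y r₁ + n' / k * Real.log v ≤ y₀ + n' / k * Real.log b :=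
        h1.trans (by gcongr)
      have := mul_le_mul_of_nonneg_left h4 hk.le
      have e1 : k * (y r₁ + n' / k * Real.log v) = k * y r₁ + n' * Real.log v := by field_simp
      have e2 : k * (y₀ + n' / k * Real.log b) = k * y₀ + n' * Real.log b := by field_simp
      linarith
    have h5 : Real.exp (k * y r₁) * v ^ n' ≤ Real.exp (k * y₀) * b ^ n' := by
      have := Real.exp_le_exp.2 h3
      rwa [Real.exp_add, Real.exp_add, Real.exp_nat_mul, Real.exp_nat_mul, Real.exp_log hv,
        Real.exp_log hb] at this
    calc θ * v ^ n' ≤ δ * (D * t ^ ((n + 2) * n')) * Real.exp (k * y r₁) * v ^ n' := by gcongr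
      _ = δ * D * t ^ ((n + 2) * n') * (Real.exp (k * y r₁) * v ^ n') := by ring
      _ ≤ δ * D * t ^ ((n + 2) * n') * (Real.exp (k * y₀) * b ^ n') := by gcongr
      _ = _ := by ring
  · have h1 := S.mass_lower_bound hM ha hk hδ.le hc₁ hχ hχc hhI' (hrel' h hhI)
    rw [show h - a = x by rw [hh]; ring] at h1
    have h2 := S.hv h hhI'
    have h3 : 4 * π * a ^ 2 * c₁ * (δ * Real.exp (k * y h) * t ^ ((n + 2) * n' + 1)) ≤ b := by
      rw [← hXx]
      have := hhI'.2
      linarith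
    have h4 : Real.exp (k * (y h - y r₁)) * Real.exp (k * y r₁) = Real.exp (k * y h) := by
      rw [← Real.exp_add]; ring_nf
    rw [le_div_iff₀ hθ, le_div_iff₀ (by positivity)]
    calc Real.exp (k * (y h - y r₁)) * t * θ * (4 * π * a ^ 2 * c₁)
        ≤ Real.exp (k * (y h - y r₁)) * t * (δ * (D * t ^ ((n + 2) * n')) * Real.exp (k * y r₁))
          * (4 * π * a ^ 2 * c₁) := by gcongr
      _ = D * (4 * π * a ^ 2 * c₁ * (δ * (Real.exp (k * (y h - y r₁)) * Real.exp (k * y r₁)) *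
          t ^ ((n + 2) * n' + 1))) := by ring
      _ ≤ D * b := by rw [h4]; gcongr
  · have h1 := S.steep_of_relativistic hM ha hδ.le hχ (γ := n * k) (by positivity) hn hr₁.2 hhI hrel'
    rw [← hvdef, mul_assoc (n : ℝ), Real.exp_nat_mul] at h1
    set W := Real.exp (k * (y h - y r₁)) with hW
    have h2 : k * (y h - y r₁) ≤ W := by linarith [Real.add_one_le_exp (k * (y h - y r₁))]
    have h3 : t ≤ 2 * D * (r₁ - h) := by rw [hh]; linarith
    rw [div_mul_eq_mul_div, div_le_iff₀ (by positivity)]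
    calc k * M * t ≤ k * M * (2 * D * (r₁ - h)) := by gcongr
      _ = 2 * D * k * (M * (r₁ - h)) := by ring
      _ ≤ 2 * D * k * (b * (v * W ^ n) * (y h - y r₁)) := by gcongr
      _ = 2 * D * (b * (v * W ^ n)) * (k * (y h - y r₁)) := by ring
      _ ≤ 2 * D * (b * (v * W ^ n)) * W := by gcongr
      _ = _ := by ring

/-- A priori bound: small smooth shells cannot become relativistic. -/
theorem exists_upper_bound (hχs : ContDiff ℝ (⊤ : ℕ∞) χ) (hχ0 : ∀ x ≤ 0, χ x = 0)
    (hχ : ∀ x, 0 ≤ χ x) (hM : 0 < M) (ha : 2 * M < a) (hab : a ≤ b)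
    (hk : 0 < k) (hC₁ : 0 < C₁) (hc₁ : 0 < c₁) (ystar y₀ : ℝ) :
    ∃ δ₁ C : ℝ, 0 < δ₁ ∧ ∀ δ, 0 < δ → δ ≤ δ₁ → ∀ y m ρ p : ℝ → ℝ,
      ShellData M a b k C₁ c₁ ystar δ χ y m ρ p → y b = y₀ → ∀ r ∈ Icc a b, y r ≤ C := by
  have ha0 : 0 < a := by linarith
  have hb : 0 < b := ha0.trans_le hab
  have hχc := hχs.continuous
  obtain ⟨n, hn⟩ := exists_nat_ge (2 * C₁ / (k * c₁))
  obtain ⟨n', hn'⟩ := exists_nat_ge (max 1 (2 * k))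
  have hn'1 : (1:ℝ) ≤ n' := (le_max_left _ _).trans hn'
  have hn'0 : n' ≠ 0 := by rintro rfl; norm_num at hn'1
  rw [div_le_iff₀ (by positivity)] at hn
  obtain ⟨D₀, -, hD₀⟩ := flat_primitive_bound χ hχs hχ0 hχ (b - a) ((n + 2) * n')
  set D := max D₀ 1 with hDdef
  have hD1 : 1 ≤ D := le_max_right _ _
  have hXnn : ∀ x, 0 ≤ x → 0 ≤ ∫ s in (0:ℝ)..x, χ s := fun x hx =>
    intervalIntegral.integral_nonneg hx fun s _ => hχ s
  have hflat : ∀ x ≤ b - a, χ x ^ ((n + 2) * n' + 1) ≤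
      D * (∫ s in (0:ℝ)..x, χ s) ^ ((n + 2) * n') := fun x hx => by
    rcases le_total x 0 with h | h
    · rw [show (∫ s in (0:ℝ)..x, χ s) = 0 from by
        rw [intervalIntegral.integral_congr (g := fun _ => (0:ℝ)) fun s hs => by
          rw [uIcc_of_ge h] at hs
          exact hχ0 s hs.2]
        simp, hχ0 x h, zero_pow (by positivity), zero_pow (by positivity), mul_zero]
    · refine (hD₀ x hx).trans ?_
      have := hXnn x h
      gcongr
      exact le_max_left _ _
  obtain ⟨S₀, hS₀⟩ := (isCompact_Icc (a := (0:ℝ)) (b := b - a)).bddAbove_image hχc.continuousOn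
  have hS : ∀ r ∈ Icc a b, χ (r - a) ≤ max S₀ 1 := fun r hr =>
    (hS₀ ⟨r - a, ⟨by linarith [hr.1], by linarith [hr.2]⟩, rfl⟩).trans (le_max_left _ _)
  set S₁ := max S₀ 1
  have hS₁ : 0 < S₁ := zero_lt_one.trans_le (le_max_right _ _)
  set θ := 1 / (16 * π * b ^ 2 * C₁) with hθdef
  have hθ : 0 < θ := by positivity
  set A := θ * (k * M / (2 * b * D)) ^ n' with hAdef
  have hA : 0 < A := by positivity
  set B := D * (Real.exp (k * y₀) * b ^ n') *
        (D * b / (4 * π * a ^ 2 * c₁) / θ) ^ ((n + 1) * n') with hBdef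
  have hB : 0 < B := by positivity
  set β := (n' : ℝ) / k
  have hβ : 2 ≤ β := (le_div_iff₀ hk).2 ((le_max_right _ _).trans hn')
  refine ⟨min (θ / (S₁ * Real.exp (k * ystar))) (A / (2 * B)),
    y₀ + β * Real.log b - β * Real.log (a - 2 * M), by positivity, ?_⟩
  intro δ hδ hδle y m ρ p S hyb
  have hanti := S.antitoneOn hM ha0
  have haI : a ∈ Icc a b := left_mem_Icc.2 hab
  have hbI : b ∈ Icc a b := right_mem_Icc.2 hab
  have hyc : ContinuousOn y (Icc a b) := fun r hr => (S.hy r hr).continuousAt.continuousWithinAt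
  have hqc : ContinuousOn (fun r => δ * χ (r - a) * Real.exp (k * y r)) (Icc a b) := by fun_prop
  by_cases hT : ∃ r ∈ Icc a b, θ ≤ δ * χ (r - a) * Real.exp (k * y r)
  · exfalso
    have hcl : IsCompact (Icc a b ∩ (fun r => δ * χ (r - a) * Real.exp (k * y r)) ⁻¹' Ici θ) :=
      isCompact_Icc.of_isClosed_subset (hqc.preimage_isClosed_of_isClosed isClosed_Icc isClosed_Ici)
        inter_subset_left
    obtain ⟨r₁, hr₁, hr₁max⟩ := hcl.exists_isGreatest
      (let ⟨r, hr, h⟩ := hT; ⟨r, hr, h⟩)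
    have hdense : θ ≤ δ * χ (r₁ - a) * Real.exp (k * y r₁) := hr₁.2
    have hrel : ystar ≤ y r₁ := by
      have h1 : δ * (S₁ * Real.exp (k * ystar)) ≤ θ :=
        (le_div_iff₀ (by positivity)).1 (hδle.trans (min_le_left _ _))
      have h2 : θ ≤ δ * (S₁ * Real.exp (k * y r₁)) := by
        refine hdense.trans ?_
        rw [mul_assoc]
        have := hS r₁ hr₁.1
        gcongr
      have h3 := le_of_mul_le_mul_left (le_of_mul_le_mul_left (h1.trans h2) hδ) hS₁
      exact le_of_mul_le_mul_left (Real.exp_le_exp.1 h3) hk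
    have hlow : ∀ r ∈ Ioo r₁ b, δ * χ (r - a) * Real.exp (k * y r) ≤ θ := fun r hr => by
      by_contra hcon
      exact absurd (hr₁max ⟨⟨hr₁.1.1.trans hr.1.le, hr.2.le⟩, (not_le.1 hcon).le⟩) (not_le.2 hr.1)
    have h1 : A ≤ δ * B := S.amplitude_lower_bound_of_dense hχc hχ hM ha0 hk hC₁ hc₁
      (by linarith) hn'0 ((le_max_right _ _).trans hn') hD1 hflat hδ hyb hθ le_rfl hr₁.1
      hdense hlow hrel
    have h2 : δ * (2 * B) ≤ A := (le_div_iff₀ (by positivity)).1 (hδle.trans (min_le_right _ _))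
    linarith
  · push Not at hT
    intro r hr
    refine (hanti haI hr hr.1).trans ?_
    have h1 := (S.monotoneOn_of_low_density ha0 hC₁ hβ le_rfl
      fun r hr => (hT r (Ioo_subset_Icc_self hr)).le).1 haI hbI hab
    simp only [hyb, S.hma, mul_zero, sub_zero] at h1
    have h2 : Real.log (b - 2 * M - 2 * m b) ≤ Real.log b :=
      Real.log_le_log (S.hv b hbI) (S.radius_le hM hbI)
    have h3 : β * Real.log (b - 2 * M - 2 * m b) ≤ β * Real.log b := by gcongr
    linarith

end ShellData

/-- The standing assumptions on the matter model. -/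
structure MatterModel (M l L₀ α₀ sL η₀ : ℝ) (Φ χ : ℝ → ℝ) : Prop where
  hM : 0 < M
  hl : -(1/2) < l
  hc : 0 < cConst l
  hΦmeas : Measurable Φ
  hΦ : ∀ a b : ℝ, IntervalIntegrable Φ volume a b
  hΦ0 : ∀ x, 0 ≤ Φ x
  hα₀ : 0 < α₀
  hΦpos : ∀ x ∈ Ioo 0 α₀, 0 < Φ x
  hL₀ : 12 * M ^ 2 < L₀
  hsL : 2 * M < sL
  hη₀ : 0 < η₀
  hχ : ContDiff ℝ (⊤ : ℕ∞) χ
  hχnonneg : ∀ x, 0 ≤ χ x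
  hχ0 : ∀ x ≤ 0, χ x = 0
  hχ1 : ∀ x, η₀ ≤ x → χ x = 1

namespace MatterModel

variable {M l L₀ α₀ sL η₀ δ y₀ : ℝ} {Φ χ y : ℝ → ℝ}

theorem L₀_nonneg (P : MatterModel M l L₀ α₀ sL η₀ Φ χ) : 0 ≤ L₀ := by
  nlinarith [P.hL₀, sq_nonneg M]

theorem rho_eq_zero (P : MatterModel M l L₀ α₀ sL η₀ Φ χ) {r : ℝ} (hr : r ≤ sL) :
    rhoFun l L₀ δ sL Φ χ y r = 0 := by
  rw [rhoFun, P.hχ0 _ (by linarith), mul_zero, zero_mul]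

theorem rho_nonneg (P : MatterModel M l L₀ α₀ sL η₀ Φ χ) (hδ : 0 ≤ δ) {r : ℝ} (hr : 0 < r) :
    0 ≤ rhoFun l L₀ δ sL Φ χ y r :=
  mul_nonneg (mul_nonneg hδ (P.hχnonneg _)) (matter_nonneg P.hΦ P.hΦ0 P.hl P.L₀_nonneg hr _).1

theorem p_nonneg (P : MatterModel M l L₀ α₀ sL η₀ Φ χ) (hδ : 0 ≤ δ) {r : ℝ} (hr : 0 < r) :
    0 ≤ pFun l L₀ δ sL Φ χ y r :=
  mul_nonneg (mul_nonneg hδ (P.hχnonneg _)) (matter_nonneg P.hΦ P.hΦ0 P.hl P.L₀_nonneg hr _).2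

theorem continuousOn_y (S : IsShellSolution M l L₀ δ sL y₀ Φ χ y) :
    ContinuousOn y (Ioi (2 * M)) :=
  fun r hr => (S.2.2 r hr).continuousAt.continuousWithinAt

theorem continuous_rho_integrand (P : MatterModel M l L₀ α₀ sL η₀ Φ χ)
    (S : IsShellSolution M l L₀ δ sL y₀ Φ χ y) :
    Continuous fun s => s ^ 2 * rhoFun l L₀ δ sL Φ χ y s := by
  rw [continuous_iff_continuousAt]
  intro x
  rcases lt_or_ge x sL with h | h
  · refine (continuousAt_const (y := (0:ℝ))).congr ?_
    filter_upwards [Iio_mem_nhds h] with z hz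
    rw [P.rho_eq_zero (le_of_lt hz), mul_zero]
  · have hx : x ∈ Ioi (2 * M) := P.hsL.trans_le h
    have h1 := (matter_continuousOn (y := y) P.hΦmeas P.hΦ P.hΦ0 P.hl P.L₀_nonneg
      (s := Ioi (2 * M)) (fun r hr => lt_trans (by linarith [P.hM]) hr)
      (continuousOn_y S)).1.continuousAt (Ioi_mem_nhds hx)
    have h2 : Continuous χ := P.hχ.continuous
    unfold rhoFun
    exact (continuousAt_id.pow 2).mul
      ((continuousAt_const.mul (h2.continuousAt.comp (by fun_prop))).mul h1)

theorem hasDerivAt_mass (P : MatterModel M l L₀ α₀ sL η₀ Φ χ)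
    (S : IsShellSolution M l L₀ δ sL y₀ Φ χ y) (r : ℝ) :
    HasDerivAt (mFun M l L₀ δ sL Φ χ y) (4 * π * r ^ 2 * rhoFun l L₀ δ sL Φ χ y r) r := by
  have hc := P.continuous_rho_integrand S
  have := (intervalIntegral.integral_hasDerivAt_right (hc.intervalIntegrable (2 * M) r)
    (hc.stronglyMeasurableAtFilter _ _) hc.continuousAt).const_mul (4 * π)
  rw [mul_assoc]
  exact this

theorem mass_eq_zero (P : MatterModel M l L₀ α₀ sL η₀ Φ χ) {r : ℝ} (hr : r ≤ sL) :
    mFun M l L₀ δ sL Φ χ y r = 0 := by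
  rw [mFun, intervalIntegral.integral_congr (g := fun _ => (0:ℝ)) fun s hs => ?_]
  · simp
  · have : s ≤ sL := hs.2.trans (max_le P.hsL.le hr)
    simp only
    rw [P.rho_eq_zero this, mul_zero]

theorem mass_nonneg (P : MatterModel M l L₀ α₀ sL η₀ Φ χ) (hδ : 0 ≤ δ) {r : ℝ}
    (hr : 2 * M < r) : 0 ≤ mFun M l L₀ δ sL Φ χ y r := by
  refine mul_nonneg (by positivity) (intervalIntegral.integral_nonneg hr.le fun s hs => ?_)
  exact mul_nonneg (sq_nonneg s) (P.rho_nonneg hδ (by linarith [P.hM, hs.1]))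

theorem hasDerivAt_y (P : MatterModel M l L₀ α₀ sL η₀ Φ χ)
    (S : IsShellSolution M l L₀ δ sL y₀ Φ χ y) {r : ℝ} (hr : 2 * M < r) :
    HasDerivAt y (-((M + mFun M l L₀ δ sL Φ χ y r) / r +
      4 * π * r ^ 2 * pFun l L₀ δ sL Φ χ y r) / (r - 2 * M - 2 * mFun M l L₀ δ sL Φ χ y r)) r := by
  have hr0 : 0 < r := by linarith [P.hM]
  convert S.2.2 r hr using 1
  generalize mFun M l L₀ δ sL Φ χ y r = m
  generalize pFun l L₀ δ sL Φ χ y r = p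
  rw [show 1 - 2 / r * (M + m) = (r - 2 * M - 2 * m) / r by field_simp; ring, inv_div]
  rw [neg_div, neg_mul, neg_inj, div_mul_eq_mul_div]
  congr 1
  field_simp

theorem radius_pos (P : MatterModel M l L₀ α₀ sL η₀ Φ χ) (hδ : 0 ≤ δ)
    (S : IsShellSolution M l L₀ δ sL y₀ Φ χ y) {r : ℝ} (hr : 2 * M < r) :
    0 < r - 2 * M - 2 * mFun M l L₀ δ sL Φ χ y r := by
  by_contra hcon
  set v : ℝ → ℝ := fun r => r - 2 * M - 2 * mFun M l L₀ δ sL Φ χ y r with hv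
  have hvc : Continuous v := by
    have : Continuous (mFun M l L₀ δ sL Φ χ y) :=
      continuous_iff_continuousAt.2 fun r => (P.hasDerivAt_mass S r).continuousAt
    fun_prop
  have hvlow : ∀ s, 2 * M < s → s ≤ sL → 0 < v s := fun s hs hs' => by
    simp only [hv]
    rw [P.mass_eq_zero hs']
    linarith
  have hr' : sL < r := by
    by_contra h
    exact hcon (hvlow r hr (not_lt.1 h))
  have hK : IsCompact (Icc sL r ∩ v ⁻¹' Iic 0) := isCompact_Icc.inter_right
    (isClosed_Iic.preimage hvc)
  obtain ⟨x, hx, hxmin⟩ := hK.exists_isLeast ⟨r, ⟨hr'.le, le_rfl⟩, not_lt.1 hcon⟩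
  have hvx : v x ≤ 0 := hx.2
  have hxs : sL < x := by
    refine lt_of_le_of_ne hx.1.1 fun h => ?_
    have := hvlow sL P.hsL le_rfl
    rw [h] at this
    linarith
  have hpos : ∀ s ∈ Ioo sL x, 0 < v s := fun s hs => by
    by_contra h
    exact absurd (hxmin ⟨⟨hs.1.le, hs.2.le.trans hx.1.2⟩, not_lt.1 h⟩) (not_le.2 hs.2)
  have hx2 : 2 * M < x := P.hsL.trans hxs
  have hx0 : 0 < x := by linarith [P.hM]
  have hev : ∀ᶠ s in 𝓝[<] x, s ∈ Ioo sL x := Ioo_mem_nhdsLT hxs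
  have hvx0 : v x = 0 := by
    refine le_antisymm hvx (ge_of_tendsto (hvc.continuousAt.tendsto.mono_left nhdsWithin_le_nhds :
      Tendsto v (𝓝[<] x) _) ?_)
    filter_upwards [hev] with s hs using (hpos s hs).le
  have hlim : Tendsto (fun s => v s * deriv y s) (𝓝[<] x) (𝓝 (v x * deriv y x)) :=
    (hvc.continuousAt.mul (S.1.continuousAt (Ioi_mem_nhds hx2))).tendsto.mono_left
      nhdsWithin_le_nhds
  rw [hvx0, zero_mul] at hlim
  have hle : (0:ℝ) ≤ -(M / x) := by
    refine le_of_tendsto hlim ?_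
    filter_upwards [hev] with s hs
    have hs2 : 2 * M < s := P.hsL.trans hs.1
    have hs0 : 0 < s := by linarith [P.hM]
    have hm := P.mass_nonneg (y := y) hδ hs2
    have hp := P.p_nonneg (y := y) hδ hs0
    rw [(P.hasDerivAt_y S hs2).deriv, mul_div_cancel₀ _ (hpos s hs).ne']
    have hM := P.hM
    have h1 : M / x ≤ (M + mFun M l L₀ δ sL Φ χ y s) / s := by
      have := hs.2.le
      gcongr
      linarith
    have h2 : 0 ≤ 4 * π * s ^ 2 * pFun l L₀ δ sL Φ χ y s := by positivity
    linarith
  have := div_pos P.hM hx0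
  linarith

theorem antitoneOn_y (P : MatterModel M l L₀ α₀ sL η₀ Φ χ) (hδ : 0 ≤ δ)
    (S : IsShellSolution M l L₀ δ sL y₀ Φ χ y) {r s : ℝ} (hr : 2 * M < r) (hrs : r ≤ s) :
    y s ≤ y r := by
  have h := monotoneOn_Icc_of_hasDerivAt (f := fun r => -y r) (a := r) (b := s)
    (fun x hx => (P.hasDerivAt_y S (hr.trans_le hx.1)).neg) fun x hx => by
      have hx2 : 2 * M < x := hr.trans hx.1
      have hx0 : 0 < x := by linarith [P.hM]
      have h1 := P.mass_nonneg (y := y) hδ hx2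
      have h2 := P.p_nonneg (y := y) hδ hx0
      have h3 := P.radius_pos hδ S hx2
      have := P.hM
      rw [neg_div, neg_neg]
      positivity
  exact neg_le_neg_iff.1 (h (left_mem_Icc.2 hrs) (right_mem_Icc.2 hrs) hrs)

/-- Uniform upper bound for small amplitudes. -/
theorem exists_upper_bound (P : MatterModel M l L₀ α₀ sL η₀ Φ χ) (y₀ : ℝ) :
    ∃ δ₁ C : ℝ, 0 < δ₁ ∧ ∀ δ, 0 < δ → δ ≤ δ₁ → ∀ y, IsShellSolution M l L₀ δ sL y₀ Φ χ y →
      ∀ r, min sL (4 * M) ≤ r → y r ≤ C := by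
  have hM := P.hM
  have key : ∀ {δ y r}, 0 ≤ δ → IsShellSolution M l L₀ δ sL y₀ Φ χ y → 4 * M ≤ r → y r ≤ y₀ :=
    fun hδ S hr => S.2.1 ▸ P.antitoneOn_y hδ S (by linarith) hr
  rcases le_or_gt (4 * M) sL with h | h
  · exact ⟨1, y₀, one_pos, fun δ hδ _ y S r hr => key hδ.le S ((min_eq_right h) ▸ hr)⟩
  have hs0 : 0 < sL := by linarith [P.hsL]
  obtain ⟨C₁, hC₁, hle⟩ := matter_le (R := 4 * M) P.hΦ P.hΦ0 P.hl P.L₀_nonneg hs0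
  obtain ⟨c₁, ystar, hc₁, hge⟩ := le_matter (R := 4 * M) P.hΦ P.hΦ0 P.hα₀ P.hΦpos P.hl
    P.L₀_nonneg P.hc hs0
  obtain ⟨δ₁, C, hδ₁, hC⟩ := ShellData.exists_upper_bound P.hχ P.hχ0 P.hχnonneg hM P.hsL h.le
    (by linarith [P.hl] : 0 < 2 * l + 4) hC₁ hc₁ ystar y₀
  refine ⟨δ₁, max C y₀, hδ₁, fun δ hδ hδle y S r hr => ?_⟩
  rw [min_eq_left h.le] at hr
  rcases le_total (4 * M) r with h4 | h4
  · exact (key hδ.le S h4).trans (le_max_right _ _)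
  refine (hC δ hδ hδle y (mFun M l L₀ δ sL Φ χ y) (rhoFun l L₀ δ sL Φ χ y)
    (pFun l L₀ δ sL Φ χ y) ?_ S.2.1 r ⟨hr, h4⟩).trans (le_max_left _ _)
  have hq : ∀ r, 0 ≤ δ * χ (r - sL) := fun r => mul_nonneg hδ.le (P.hχnonneg _)
  exact {
    hm := fun r _ => P.hasDerivAt_mass S r
    hma := P.mass_eq_zero le_rfl
    hv := fun r hr => P.radius_pos hδ.le S (P.hsL.trans_le hr.1)
    hy := fun r hr => P.hasDerivAt_y S (P.hsL.trans_le hr.1)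
    hρ0 := fun r hr => P.rho_nonneg hδ.le (hs0.trans_le hr.1)
    hp0 := fun r hr => P.p_nonneg hδ.le (hs0.trans_le hr.1)
    hρ := fun r hr => by
      have := mul_le_mul_of_nonneg_left (hle r hr (y r)).1 (hq r)
      rw [rhoFun]; linarith
    hp := fun r hr => by
      have := mul_le_mul_of_nonneg_left (hle r hr (y r)).2 (hq r)
      rw [pFun]; linarith
    hρl := fun r hr hy => by
      have := mul_le_mul_of_nonneg_left (hge r hr (y r) hy).1 (hq r)
      rw [rhoFun]; linarith
    hpl := fun r hr hy => by
      have := mul_le_mul_of_nonneg_left (hge r hr (y r) hy).2 (hq r)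
      rw [pFun]; linarith }

end MatterModel

theorem abs_sub_le_of_hasDerivAt {f f' : ℝ → ℝ} {a b C : ℝ}
    (hf : ∀ x ∈ Icc a b, HasDerivAt f (f' x) x) (hC : ∀ x ∈ Icc a b, |f' x| ≤ C)
    {x z : ℝ} (hx : x ∈ Icc a b) (hz : z ∈ Icc a b) : |f x - f z| ≤ C * |x - z| :=
  (convex_Icc a b).norm_image_sub_le_of_norm_hasDerivWithin_le
    (fun x hx => (hf x hx).hasDerivWithinAt) hC hz hx

theorem hasDerivAt_one_sub_div (M : ℝ) {r : ℝ} (hr : r ≠ 0) :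
    HasDerivAt (fun r => 1 - 2 * M / r) (2 * M / r ^ 2) r := by
  refine (((hasDerivAt_const r (2 * M)).div (hasDerivAt_id r) hr).const_sub 1).congr_deriv ?_
  simp
  ring

theorem hasDerivAt_one_add_div_sq (L : ℝ) {r : ℝ} (hr : r ≠ 0) :
    HasDerivAt (fun r => 1 + L / r ^ 2) (-(2 * L / r ^ 3)) r := by
  refine (((hasDerivAt_const r L).div (hasDerivAt_pow 2 r) (by positivity)).const_add 1).congr_deriv
    ?_
  field_simp
  norm_num
  ring

/-- The vacuum solution `y⁰`. -/
def vacuumY (M E r : ℝ) : ℝ := Real.log E - Real.log (1 - 2 * M / r) / 2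

theorem hasDerivAt_vacuumY {M E r : ℝ} (hM : 0 < M) (hr : 2 * M < r) :
    HasDerivAt (vacuumY M E) (-(M / (r * (r - 2 * M)))) r := by
  have hr0 : 0 < r := by linarith
  have h1 : 0 < 1 - 2 * M / r := by rw [sub_pos, div_lt_one hr0]; exact hr
  refine ((((hasDerivAt_one_sub_div M hr0.ne').log h1.ne').div_const 2).const_sub (Real.log E)).congr_deriv ?_
  have h3 : r - 2 * M ≠ 0 := by linarith
  have h4 : 1 - 2 * M / r = (r - 2 * M) / r := by field_simp
  rw [h4]
  field_simp

theorem vacuumY_four {M E : ℝ} (hM : 0 < M) (hE : 0 < E) :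
    vacuumY M E (4 * M) = Real.log (Real.sqrt 2 * E) := by
  rw [vacuumY, Real.log_mul (by positivity) hE.ne', Real.log_sqrt (by norm_num),
    show 1 - 2 * M / (4 * M) = 2⁻¹ by field_simp; norm_num, Real.log_inv]
  ring

namespace MatterModel

variable {M l L₀ α₀ sL η₀ : ℝ} {Φ χ : ℝ → ℝ}

/-- Density, pressure and mass are of the order of the amplitude. -/
theorem exists_matter_bound (P : MatterModel M l L₀ α₀ sL η₀ Φ χ) (y₀ : ℝ) {R : ℝ}
    (hR : sL ≤ R) :
    ∃ δ₁ K : ℝ, 0 < δ₁ ∧ 0 ≤ K ∧ ∀ δ, 0 < δ → δ ≤ δ₁ →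
      ∀ y, IsShellSolution M l L₀ δ sL y₀ Φ χ y → ∀ r ∈ Icc (min sL (4 * M)) R,
        rhoFun l L₀ δ sL Φ χ y r ≤ K * δ ∧ pFun l L₀ δ sL Φ χ y r ≤ K * δ ∧
        mFun M l L₀ δ sL Φ χ y r ≤ K * δ := by
  have hM := P.hM
  set a := min sL (4 * M) with ha
  have ha2 : 2 * M < a := lt_min P.hsL (by linarith)
  have ha0 : 0 < a := by linarith
  have has : a ≤ sL := min_le_left _ _
  obtain ⟨δ₁, C, hδ₁, hC⟩ := P.exists_upper_bound y₀
  obtain ⟨C₁, hC₁, hle⟩ := matter_le (R := R) P.hΦ P.hΦ0 P.hl P.L₀_nonneg ha0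
  obtain ⟨X, hX⟩ := (isCompact_Icc (a := (0:ℝ)) (b := R - sL)).bddAbove_image
    P.hχ.continuous.continuousOn
  have hXnn : 0 ≤ X := (P.hχnonneg 0).trans (hX ⟨0, ⟨le_rfl, by linarith⟩, rfl⟩)
  have hX' : ∀ r ≤ R, χ (r - sL) ≤ X := fun r hr => by
    rcases le_total r sL with h | h
    · rw [P.hχ0 _ (by linarith)]; exact hXnn
    · exact hX ⟨r - sL, ⟨by linarith, by linarith⟩, rfl⟩
  have hl := P.hl
  set K₁ := X * (C₁ * Real.exp ((2 * l + 4) * C)) with hK₁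
  have hK₁0 : 0 ≤ K₁ := by positivity
  have hRa : 0 ≤ R - a := by linarith
  have hK₂0 : 0 ≤ 4 * π * R ^ 2 * K₁ * (R - a) := by positivity
  refine ⟨δ₁, K₁ + 4 * π * R ^ 2 * K₁ * (R - a), hδ₁, by positivity, fun δ hδ hδle y S => ?_⟩
  have hy : ∀ r ∈ Icc a R, Real.exp ((2 * l + 4) * y r) ≤ Real.exp ((2 * l + 4) * C) :=
    fun r hr => Real.exp_le_exp.2
      (mul_le_mul_of_nonneg_left (hC δ hδ hδle y S r hr.1) (by linarith))
  have hbd : ∀ r ∈ Icc a R, ∀ z, z ≤ C₁ * Real.exp ((2 * l + 4) * y r) →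
      δ * χ (r - sL) * z ≤ K₁ * δ := fun r hr z hz => by
    have h1 := P.hχnonneg (r - sL)
    calc δ * χ (r - sL) * z ≤ δ * χ (r - sL) * (C₁ * Real.exp ((2 * l + 4) * C)) := by
          gcongr; exact hz.trans (mul_le_mul_of_nonneg_left (hy r hr) hC₁.le)
      _ ≤ δ * X * (C₁ * Real.exp ((2 * l + 4) * C)) := by
          gcongr; exact hX' r hr.2
      _ = K₁ * δ := by rw [hK₁]; ring
  have hρ : ∀ r ∈ Icc a R, rhoFun l L₀ δ sL Φ χ y r ≤ K₁ * δ := fun r hr =>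
    hbd r hr _ (hle r hr (y r)).1
  have hp : ∀ r ∈ Icc a R, pFun l L₀ δ sL Φ χ y r ≤ K₁ * δ := fun r hr =>
    hbd r hr _ (hle r hr (y r)).2
  have hm : ∀ r ∈ Icc a R, mFun M l L₀ δ sL Φ χ y r ≤ 4 * π * R ^ 2 * K₁ * (R - a) * δ := by
    intro r hr
    have hmono := monotoneOn_Icc_of_hasDerivAt (a := a) (b := R) (fun x _ =>
      ((hasDerivAt_id x).const_mul (4 * π * R ^ 2 * (K₁ * δ))).sub
        (P.hasDerivAt_mass S x)) fun x hx => by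
        have hx0 : 0 ≤ x := (ha0.trans hx.1).le
        have h1 := hρ x (Ioo_subset_Icc_self hx)
        have h2 : x ^ 2 ≤ R ^ 2 := pow_le_pow_left₀ hx0 hx.2.le 2
        rw [mul_one, sub_nonneg]
        calc 4 * π * x ^ 2 * rhoFun l L₀ δ sL Φ χ y x ≤ 4 * π * x ^ 2 * (K₁ * δ) := by gcongr
          _ ≤ 4 * π * R ^ 2 * (K₁ * δ) := by gcongr
    have h1 := hmono (left_mem_Icc.2 (hr.1.trans hr.2)) hr hr.1
    simp only [Pi.sub_apply, id, P.mass_eq_zero has, sub_zero] at h1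
    calc mFun M l L₀ δ sL Φ χ y r ≤ 4 * π * R ^ 2 * (K₁ * δ) * (r - a) := by linarith
      _ ≤ 4 * π * R ^ 2 * (K₁ * δ) * (R - a) := by
        have := hr.2
        gcongr
      _ = _ := by ring
  intro r hr
  have e1 : 0 ≤ K₁ * δ := by positivity
  have e2 : 0 ≤ 4 * π * R ^ 2 * K₁ * (R - a) * δ := by positivity
  rw [add_mul]
  exact ⟨(hρ r hr).trans (by linarith), (hp r hr).trans (by linarith), (hm r hr).trans (by linarith)⟩

/-- Closeness to the vacuum solution. -/
theorem exists_vacuum_bound (P : MatterModel M l L₀ α₀ sL η₀ Φ χ) {E : ℝ} (hE : 0 < E) {R : ℝ}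
    (hR : sL ≤ R) (hR4 : 4 * M ≤ R) :
    ∃ δ₁ K : ℝ, 0 < δ₁ ∧ 0 ≤ K ∧ ∀ δ, 0 < δ → δ ≤ δ₁ →
      ∀ y, IsShellSolution M l L₀ δ sL (Real.log (Real.sqrt 2 * E)) Φ χ y →
        (∀ r ∈ Icc (min sL (4 * M)) R,
          rhoFun l L₀ δ sL Φ χ y r ≤ K * δ ∧ pFun l L₀ δ sL Φ χ y r ≤ K * δ ∧
          mFun M l L₀ δ sL Φ χ y r ≤ K * δ ∧ |y r - vacuumY M E r| ≤ K * δ ∧ |y r| ≤ K) ∧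
        ∀ r ∈ Icc (min sL (4 * M)) R, ∀ r' ∈ Icc (min sL (4 * M)) R,
          |y r - y r'| ≤ K * |r - r'| := by
  have hM := P.hM
  set y₀ := Real.log (Real.sqrt 2 * E)
  obtain ⟨δ₁, K₁, hδ₁, hK₁, hbd⟩ := P.exists_matter_bound y₀ hR
  set a := min sL (4 * M) with ha
  have ha2 : 2 * M < a := lt_min P.hsL (by linarith)
  have ha0 : 0 < a := by linarith
  have h4I : 4 * M ∈ Icc a R := ⟨min_le_right _ _, hR4⟩
  have hRpos : 0 < R := by linarith
  set κ := (a - 2 * M) / 2 with hκ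
  have hκ0 : 0 < κ := by rw [hκ]; linarith
  set K₂ := (K₁ / (2 * M) + 4 * π * R ^ 2 * K₁) / κ + K₁ / (κ * κ) with hK₂
  have hK₂0 : 0 ≤ K₂ := by positivity
  set K₃ := 1 / (2 * κ) + K₂ with hK₃
  have hK₃0 : 0 ≤ K₃ := by positivity
  have hRa : 0 ≤ R - a := by linarith [h4I.1]
  set K := K₁ + K₂ * (R - a) + K₃ + (|y₀| + K₃ * (R - a)) with hK
  have t1 : 0 ≤ K₂ * (R - a) := by positivity
  have t2 : 0 ≤ |y₀| + K₃ * (R - a) := by positivity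
  refine ⟨min (min δ₁ 1) (κ / (2 * (K₁ + 1))), K, by positivity, by positivity,
    fun δ hδ hδle y S => ?_⟩
  have hδ1 : δ ≤ δ₁ := hδle.trans ((min_le_left _ _).trans (min_le_left _ _))
  have hδ2 : δ ≤ 1 := hδle.trans ((min_le_left _ _).trans (min_le_right _ _))
  have hδ3 : δ * (2 * (K₁ + 1)) ≤ κ := (le_div_iff₀ (by positivity)).1 (hδle.trans (min_le_right _ _))
  have hB := hbd δ hδ hδ1 y S
  have hr2 : ∀ r ∈ Icc a R, 2 * M < r := fun r hr => ha2.trans_le hr.1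
  have hdiff : ∀ r ∈ Icc a R,
      |-((M + mFun M l L₀ δ sL Φ χ y r) / r +
      4 * π * r ^ 2 * pFun l L₀ δ sL Φ χ y r) / (r - 2 * M - 2 * mFun M l L₀ δ sL Φ χ y r) -
        -(M / (r * (r - 2 * M)))| ≤ K₂ * δ := by
    intro r hr
    obtain ⟨-, hp, hm⟩ := hB r hr
    have hrM := hr2 r hr
    have hr0 : 0 < r := by linarith
    have hm0 := P.mass_nonneg (y := y) hδ.le hrM
    have hp0 := P.p_nonneg (y := y) hδ.le hr0
    set m := mFun M l L₀ δ sL Φ χ y r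
    set p := pFun l L₀ δ sL Φ χ y r
    have hw : κ ≤ r - 2 * M := by rw [hκ]; linarith [hr.1]
    have hv : κ ≤ r - 2 * M - 2 * m := by
      have := hr.1
      have : 2 * κ = a - 2 * M := by rw [hκ]; ring
      nlinarith
    have hv0 : 0 < r - 2 * M - 2 * m := hκ0.trans_le hv
    have hw0 : 0 < r - 2 * M := hκ0.trans_le hw
    have e1 : -((M + m) / r + 4 * π * r ^ 2 * p) / (r - 2 * M - 2 * m) - -(M / (r * (r - 2 * M)))
        = -((m / r + 4 * π * r ^ 2 * p) / (r - 2 * M - 2 * m) +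
          (2 * M / r) * m / ((r - 2 * M - 2 * m) * (r - 2 * M))) := by
      have gen : ∀ v w : ℝ, v ≠ 0 → w ≠ 0 → m = (w - v) / 2 →
          -((M + m) / r + 4 * π * r ^ 2 * p) / v - -(M / (r * w)) =
            -((m / r + 4 * π * r ^ 2 * p) / v + (2 * M / r) * m / (v * w)) := by
        intro v w hv hw h
        rw [h]
        field_simp
        ring
      exact gen _ _ hv0.ne' hw0.ne' (by ring)
    rw [e1, abs_neg, abs_of_nonneg (by positivity), hK₂, add_mul]
    have e2 : 2 * M / r ≤ 1 := by rw [div_le_one hr0]; exact hrM.le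
    have hrR := hr.2
    refine add_le_add ?_ ?_
    · calc (m / r + 4 * π * r ^ 2 * p) / (r - 2 * M - 2 * m)
          ≤ (K₁ * δ / (2 * M) + 4 * π * R ^ 2 * (K₁ * δ)) / κ := by gcongr
        _ = _ := by ring
    · calc (2 * M / r) * m / ((r - 2 * M - 2 * m) * (r - 2 * M))
          ≤ 1 * (K₁ * δ) / (κ * κ) := by gcongr
        _ = _ := by ring
  have hlip : ∀ r ∈ Icc a R, ∀ r' ∈ Icc a R, |y r - y r'| ≤ K₃ * |r - r'| := by
    refine fun r hr r' hr' => abs_sub_le_of_hasDerivAt (fun x hx => P.hasDerivAt_y S (hr2 x hx))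
      (fun x hx => ?_) hr hr'
    have hxM := hr2 x hx
    have hx0 : 0 < x := by linarith
    have hw : κ ≤ x - 2 * M := by rw [hκ]; linarith [hx.1]
    have hw0 : 0 < x - 2 * M := by linarith
    have e1 : |-(M / (x * (x - 2 * M)))| ≤ 1 / (2 * κ) := by
      rw [abs_neg, abs_of_nonneg (by positivity), div_le_div_iff₀ (by positivity) (by positivity)]
      nlinarith
    have e2 := hdiff x hx
    have e3 : K₂ * δ ≤ K₂ := mul_le_of_le_one_right hK₂0 hδ2
    have e4 := abs_add_le (-((M + mFun M l L₀ δ sL Φ χ y x) / x +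
      4 * π * x ^ 2 * pFun l L₀ δ sL Φ χ y x) / (x - 2 * M - 2 * mFun M l L₀ δ sL Φ χ y x) -
        -(M / (x * (x - 2 * M)))) (-(M / (x * (x - 2 * M))))
    rw [sub_add_cancel] at e4
    linarith
  have hdist : ∀ r ∈ Icc a R, |r - 4 * M| ≤ R - a := fun r hr => by
    rw [abs_le]; constructor <;> linarith [hr.1, hr.2, h4I.1, h4I.2]
  refine ⟨fun r hr => ?_, fun r hr r' hr' => (hlip r hr r' hr').trans ?_⟩
  · obtain ⟨hρ, hp, hm⟩ := hB r hr
    have hKK : K₁ * δ ≤ K * δ := by gcongr; linarith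
    refine ⟨hρ.trans hKK, hp.trans hKK, hm.trans hKK, ?_, ?_⟩
    · have h1 := abs_sub_le_of_hasDerivAt
        (fun x hx => (P.hasDerivAt_y S (hr2 x hx)).sub (hasDerivAt_vacuumY (E := E) hM (hr2 x hx)))
        hdiff hr h4I
      simp only [Pi.sub_apply] at h1
      rw [S.2.1, vacuumY_four hM hE, sub_self, sub_zero] at h1
      calc |y r - vacuumY M E r| ≤ K₂ * δ * |r - 4 * M| := h1
        _ ≤ K₂ * δ * (R - a) := by gcongr; exact hdist r hr
        _ = K₂ * (R - a) * δ := by ring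
        _ ≤ K * δ := by gcongr; linarith
    · have h1 := hlip r hr _ h4I
      rw [S.2.1] at h1
      have h2 : K₃ * |r - 4 * M| ≤ K₃ * (R - a) := by gcongr; exact hdist r hr
      have h3 := abs_add_le (y r - y₀) y₀
      rw [sub_add_cancel] at h3
      linarith
  · gcongr
    linarith

end MatterModel

theorem Psi0_hasDerivAt {M L r : ℝ} (hM : 0 < M) (hL : 0 ≤ L) (hr : 2 * M < r) :
    HasDerivAt (Psi0 M L) (Psi0 M L r *
      (-(L * (r - 3 * M) - M * r ^ 2) / (r * (r ^ 2 + L) * (r - 2 * M)))) r := by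
  have hr0 : 0 < r := by linarith
  have h1 : 0 < 1 - 2 * M / r := by rw [sub_pos, div_lt_one hr0]; exact hr
  have h2 : 0 < 1 + L / r ^ 2 := by positivity
  refine (((hasDerivAt_one_sub_div M hr0.ne').sqrt h1.ne').mul
    ((hasDerivAt_one_add_div_sq L hr0.ne').sqrt h2.ne')).congr_deriv ?_
  have e1 := Real.sq_sqrt h1.le
  have e2 := Real.sq_sqrt h2.le
  have s1 := Real.sqrt_pos.2 h1
  have s2 := Real.sqrt_pos.2 h2
  rw [Psi0]
  set A := Real.sqrt (1 - 2 * M / r)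
  set B := Real.sqrt (1 + L / r ^ 2)
  have hw : r - 2 * M ≠ 0 := by linarith
  have e1' : A ^ 2 * r = r - 2 * M := by rw [e1]; field_simp
  have e2' : B ^ 2 * r ^ 2 = r ^ 2 + L := by rw [e2]; field_simp
  rw [← e2', ← e1']
  field_simp
  linear_combination M * e2' - L * e1'

theorem Psi0_critical {M L r : ℝ} (hM : 0 < M) (hL : 0 ≤ L) (hr : 2 * M < r)
    (h : deriv (Psi0 M L) r = 0) : L * (r - 3 * M) = M * r ^ 2 := by
  have hr0 : 0 < r := by linarith
  have h1 : 0 < 1 - 2 * M / r := by rw [sub_pos, div_lt_one hr0]; exact hr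
  have h2 : 0 < 1 + L / r ^ 2 := by positivity
  have h3 : Psi0 M L r ≠ 0 := (mul_pos (Real.sqrt_pos.2 h1) (Real.sqrt_pos.2 h2)).ne'
  have h4 : 0 < r - 2 * M := by linarith
  rw [(Psi0_hasDerivAt hM hL hr).deriv, mul_eq_zero, or_iff_right h3, div_eq_zero_iff,
    or_iff_left (by positivity)] at h
  linarith

theorem log_Psi0 {M L r : ℝ} (hM : 0 < M) (hL : 0 ≤ L) (hr : 2 * M < r) :
    2 * Real.log (Psi0 M L r) = Real.log (1 - 2 * M / r) + Real.log (1 + L / r ^ 2) := by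
  have hr0 : 0 < r := by linarith
  have h1 : 0 < 1 - 2 * M / r := by rw [sub_pos, div_lt_one hr0]; exact hr
  have h2 : 0 < 1 + L / r ^ 2 := by positivity
  rw [Psi0, Real.log_mul (Real.sqrt_pos.2 h1).ne' (Real.sqrt_pos.2 h2).ne', Real.log_sqrt h1.le,
    Real.log_sqrt h2.le]
  ring

/-- The potential barrier: near its maximum, the vacuum potential exceeds the cut-off energy. -/
theorem vacuum_barrier {M L sL rL Rmin E η : ℝ} (hM : 0 < M) (hL : 0 < L) (hsL : 2 * M < sL)
    (hsr : sL < rL) (hds : deriv (Psi0 M L) sL = 0) (hdr : deriv (Psi0 M L) rL = 0)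
    (hR : Rmin < rL) (hE : Psi0 M L Rmin = E) (hη : 0 < η) (hηR : sL + η < Rmin) :
    ∃ c : ℝ, 0 < c ∧ ∀ r ∈ Icc sL (sL + η),
      2 * vacuumY M E r + c ≤ Real.log (1 + L / r ^ 2) := by
  have hs := Psi0_critical hM hL.le hsL hds
  have hr := Psi0_critical hM hL.le (hsL.trans hsr) hdr
  have hsum : L = M * (sL + rL) := by
    have : (rL - sL) * (L - M * (sL + rL)) = 0 := by linear_combination hr - hs
    rcases mul_eq_zero.1 this with h | h <;> linarith
  have hpos : ∀ r, 2 * M < r → 0 < Psi0 M L r := fun r hr => by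
    have hr0 : 0 < r := by linarith
    have h1 : 0 < 1 - 2 * M / r := by rw [sub_pos, div_lt_one hr0]; exact hr
    exact mul_pos (Real.sqrt_pos.2 h1) (Real.sqrt_pos.2 (by positivity))
  have hanti : StrictAntiOn (Psi0 M L) (Icc sL rL) := by
    refine strictAntiOn_of_deriv_neg (convex_Icc _ _) (fun x hx =>
      (Psi0_hasDerivAt hM hL.le (hsL.trans_le hx.1)).continuousAt.continuousWithinAt) fun x hx => ?_
    rw [interior_Icc] at hx
    have hx2 : 2 * M < x := hsL.trans hx.1
    have hx0 : 0 < x := by linarith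
    have hxw : 0 < x - 2 * M := by linarith
    rw [(Psi0_hasDerivAt hM hL.le hx2).deriv]
    refine mul_neg_of_pos_of_neg (hpos x hx2) (div_neg_of_neg_of_pos ?_ (by positivity))
    have h1 : L * (x - 3 * M) - M * x ^ 2 = M * ((x - sL) * (rL - x)) := by
      have h2 : L * (x - sL) = M * (sL + rL) * (x - sL) := by rw [hsum]
      linear_combination hs + h2
    have : 0 < M * ((x - sL) * (rL - x)) :=
      mul_pos hM (mul_pos (sub_pos.2 hx.1) (sub_pos.2 hx.2))
    linarith
  have hI : sL + η ∈ Icc sL rL := ⟨by linarith, by linarith⟩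
  have hlt : E < Psi0 M L (sL + η) := hE ▸ hanti hI ⟨by linarith, hR.le⟩ hηR
  have hE0 : 0 < E := hE ▸ hpos Rmin (by linarith)
  refine ⟨2 * (Real.log (Psi0 M L (sL + η)) - Real.log E), ?_, fun r hr => ?_⟩
  · have := Real.log_lt_log hE0 hlt
    linarith
  · have hr2 : 2 * M < r := hsL.trans_le hr.1
    have h1 : Psi0 M L (sL + η) ≤ Psi0 M L r :=
      hanti.antitoneOn ⟨hr.1, hr.2.trans hI.2⟩ hI hr.2
    have h2 := Real.log_le_log (hpos _ (by linarith)) h1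
    have h3 := log_Psi0 hM hL.le hr2
    rw [vacuumY]
    linarith

theorem exists_vacuumY_neg {M E : ℝ} (hE0 : 0 < E) (hE : E < 1) (A : ℝ) :
    ∃ R, A < R ∧ vacuumY M E R < 0 := by
  have h1 : Tendsto (fun r : ℝ => 1 - 2 * M / r) atTop (𝓝 (1 - 0)) :=
    tendsto_const_nhds.sub (tendsto_const_nhds.div_atTop tendsto_id)
  have h2 : Tendsto (vacuumY M E) atTop (𝓝 (Real.log E - Real.log (1 - 0) / 2)) :=
    tendsto_const_nhds.sub ((h1.log (by norm_num)).div_const 2)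
  have h3 : Real.log E - Real.log (1 - 0) / 2 < 0 := by
    rw [sub_zero, Real.log_one, zero_div, sub_zero]
    exact Real.log_neg hE0 hE
  exact ((eventually_gt_atTop A).and (h2.eventually_lt_const h3)).exists

theorem one_add_div_mono {L L' r : ℝ} (h : L ≤ L') : 1 + L / r ^ 2 ≤ 1 + L' / r ^ 2 := by
  gcongr

/-- Two critical radii of the effective potential cannot coexist for small perturbations. -/
theorem no_two_critical_radii {M L L₀ sL η r₁ r₂ e₁ e₂ A B δ : ℝ} (hM : 0 < M) (hη : 0 < η)
    (hL : L₀ ≤ L) (hs : L₀ * (sL - 3 * M) = M * sL ^ 2) (hs3 : 3 * M ≤ sL)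
    (hr₁ : sL + η ≤ r₁) (hr : r₁ < r₂)
    (h₁ : L * (r₁ - 3 * M) - M * r₁ ^ 2 = e₁) (h₂ : L * (r₂ - 3 * M) - M * r₂ ^ 2 = e₂)
    (he₁ : e₁ ≤ A * δ) (he : -(B * δ) * (r₂ - r₁) ≤ e₂ - e₁) (hAδ : 0 ≤ A * δ)
    (hδ : (A + η * B) * δ < M * η ^ 2) : False := by
  have h3 : 0 ≤ (L - L₀) * (sL - 3 * M) := mul_nonneg (by linarith) (by linarith)
  have h4 : (r₁ - sL) * (L - M * (r₁ + sL)) ≤ A * δ := by nlinarith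
  have h5 : η * (L - M * (r₁ + sL)) ≤ A * δ := by
    rcases le_total 0 (L - M * (r₁ + sL)) with h | h
    · exact (mul_le_mul_of_nonneg_right (by linarith) h).trans h4
    · exact (mul_nonpos_of_nonneg_of_nonpos hη.le h).trans hAδ
  have h6 : -(B * δ) ≤ L - M * (r₁ + r₂) := by
    refine le_of_mul_le_mul_right (he.trans (le_of_eq ?_)) (sub_pos.2 hr)
    rw [← h₁, ← h₂]
    ring
  have h7 : η * (M * (r₂ - sL)) ≤ A * δ + η * (B * δ) := by nlinarith
  have h8 : η * (M * η) ≤ η * (M * (r₂ - sL)) := by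
    gcongr
    linarith
  nlinarith

/-- The effective potential is below the cut-off energy exactly where `1 + L / r ^ 2 < e ^ (2 y)`. -/
theorem potential_lt_iff {z y B : ℝ} :
    Real.exp (z - y) * Real.sqrt B < Real.exp z ↔ B < Real.exp (2 * y) := by
  rw [← cutoff_cond_iff, sub_eq_add_neg, Real.exp_add, mul_assoc,
    mul_lt_iff_lt_one_right (Real.exp_pos _)]

namespace MatterModel

variable {M l L₀ α₀ sL η₀ δ y₀ R : ℝ} {Φ χ y : ℝ → ℝ}

/-- The region below the cut-off energy lies strictly inside the plateau of the shell. -/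
theorem mem_well_iff (P : MatterModel M l L₀ α₀ sL η₀ Φ χ) (hδ : 0 < δ)
    (hlow : ∀ r ∈ Icc sL (sL + η₀), Real.exp (2 * y r) ≤ 1 + L₀ / r ^ 2)
    (hhigh : ∀ r, R ≤ r → Real.exp (2 * y r) ≤ 1 + L₀ / r ^ 2)
    {L z : ℝ} (hL : L₀ ≤ L) (r : ℝ) :
    (2 * M < r ∧ Real.exp (z - y r) * Real.sqrt (1 + L / r ^ 2) < Real.exp z ∧
        0 < rhoFun l L₀ δ sL Φ χ y r) ↔
      r ∈ Ioo (sL + η₀) R ∧ 1 + L / r ^ 2 < Real.exp (2 * y r) := by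
  rw [potential_lt_iff]
  constructor
  · rintro ⟨-, h2, h3⟩
    have h4 := (one_add_div_mono hL).trans_lt h2
    refine ⟨⟨?_, ?_⟩, h2⟩
    · by_contra h
      rcases le_total r sL with h5 | h5
      · rw [P.rho_eq_zero h5] at h3
        exact lt_irrefl _ h3
      · exact absurd h4 (not_lt.2 (hlow r ⟨h5, not_lt.1 h⟩))
    · by_contra h
      exact absurd h4 (not_lt.2 (hhigh r (not_lt.1 h)))
  · rintro ⟨⟨h1, -⟩, h2⟩
    have h3 : 2 * M < r := by linarith [P.hsL, P.hη₀]
    have h4 := (one_add_div_mono hL).trans_lt h2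
    refine ⟨h3, h2, ?_⟩
    rw [rhoFun, P.hχ1 _ (by linarith), mul_one]
    exact mul_pos hδ (Gfun_pos P.hΦ P.hΦ0 P.hα₀ P.hΦpos P.hl P.L₀_nonneg P.hc
      (by linarith [P.hM]) h4)

/-- The critical radii of the effective potential. -/
theorem critical_radius_eq (P : MatterModel M l L₀ α₀ sL η₀ Φ χ) (hδ : 0 < δ)
    (S : IsShellSolution M l L₀ δ sL y₀ Φ χ y) {L z r : ℝ} (hL : 0 ≤ L) (hr : 2 * M < r)
    (h : deriv (fun r => Real.exp (z - y r) * Real.sqrt (1 + L / r ^ 2)) r = 0) :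
    L * (r - 3 * M) - M * r ^ 2 =
      (3 * L + r ^ 2) * mFun M l L₀ δ sL Φ χ y r +
        4 * π * (L * r ^ 3 + r ^ 5) * pFun l L₀ δ sL Φ χ y r := by
  have hr0 : 0 < r := by linarith [P.hM]
  have h2 : 0 < 1 + L / r ^ 2 := by positivity
  have d1 := ((P.hasDerivAt_y S hr).const_sub z).exp
  have hv := P.radius_pos hδ.le S hr
  have hd : HasDerivAt (fun r => Real.exp (z - y r) * Real.sqrt (1 + L / r ^ 2)) _ r :=
    d1.mul ((hasDerivAt_one_add_div_sq L hr0.ne').sqrt h2.ne')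
  rw [hd.deriv] at h
  set m := mFun M l L₀ δ sL Φ χ y r
  set p := pFun l L₀ δ sL Φ χ y r
  have hv' : ∃ v, v = r - 2 * M - 2 * m := ⟨_, rfl⟩
  obtain ⟨v, hvdef⟩ := hv'
  rw [← hvdef] at h hv
  have s2 := Real.sqrt_pos.2 h2
  have e2 := Real.sq_sqrt h2.le
  set B := Real.sqrt (1 + L / r ^ 2)
  have e2' : B ^ 2 * r ^ 2 = r ^ 2 + L := by rw [e2]; field_simp
  have hexp := (Real.exp_pos (z - y r)).ne'
  set X := Real.exp (z - y r)
  have h3 : ((M + m) / r + 4 * π * r ^ 2 * p) * B ^ 2 * r ^ 3 = L * v := by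
    field_simp at h
    field_simp
    refine mul_left_cancel₀ hexp ?_
    linear_combination h
  have h4 : (M + m + 4 * π * r ^ 3 * p) * (B ^ 2 * r ^ 2) = L * v := by
    rw [← h3]
    field_simp
  rw [e2', hvdef] at h4
  linear_combination -h4

/-- Existence and uniqueness of the critical radius, given quantitative smallness. -/
theorem existsUnique_critical_radius (P : MatterModel M l L₀ α₀ sL η₀ Φ χ) (hδ : 0 < δ)
    (S : IsShellSolution M l L₀ δ sL y₀ Φ χ y) {K B : ℝ} (hB : 0 ≤ B)
    (hs : L₀ * (sL - 3 * M) = M * sL ^ 2)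
    (hlow : ∀ r ∈ Icc sL (sL + η₀), Real.exp (2 * y r) ≤ 1 + L₀ / r ^ 2)
    (hhigh : ∀ r, R ≤ r → Real.exp (2 * y r) ≤ 1 + L₀ / r ^ 2)
    (hbd : ∀ r ∈ Icc (sL + η₀) R, mFun M l L₀ δ sL Φ χ y r ≤ K * δ ∧
      pFun l L₀ δ sL Φ χ y r ≤ K * δ ∧ y r ≤ K)
    (hlip : ∀ r ∈ Icc (sL + η₀) R, ∀ r' ∈ Icc (sL + η₀) R,
      |pFun l L₀ δ sL Φ χ y r - pFun l L₀ δ sL Φ χ y r'| ≤ B * δ * |r - r'|)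
    (hsmall : (((3 * (R ^ 2 * Real.exp (2 * K)) + R ^ 2) * K +
      4 * π * (R ^ 2 * Real.exp (2 * K) * R ^ 3 + R ^ 5) * K) +
        η₀ * (4 * π * (R ^ 2 * Real.exp (2 * K) * R ^ 3 + R ^ 5) * B)) * δ < M * η₀ ^ 2)
    {L z : ℝ} (hL : L₀ ≤ L)
    (hne : {r : ℝ | 2 * M < r ∧
        Real.exp (z - y r) * Real.sqrt (1 + L / r ^ 2) < Real.exp z ∧
        0 < rhoFun l L₀ δ sL Φ χ y r}.Nonempty) :
    ∃! x : ℝ, x ∈ {r : ℝ | 2 * M < r ∧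
        Real.exp (z - y r) * Real.sqrt (1 + L / r ^ 2) < Real.exp z ∧
        0 < rhoFun l L₀ δ sL Φ χ y r} ∧
      deriv (fun r => Real.exp (z - y r) * Real.sqrt (1 + L / r ^ 2)) x = 0 := by
  have hM := P.hM
  have hη := P.hη₀
  have hsL := P.hsL
  have hL₀ := P.L₀_nonneg
  have hL0 : 0 ≤ L := hL₀.trans hL
  have hmem : ∀ r, _ ↔ _ := P.mem_well_iff (z := z) hδ hlow hhigh hL
  set f : ℝ → ℝ := fun r => Real.exp (z - y r) * Real.sqrt (1 + L / r ^ 2) with hf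
  simp only [Set.mem_ofPred_eq]
  refine existsUnique_of_exists_of_unique ?_ ?_
  · obtain ⟨r₀, hr₀⟩ := hne
    obtain ⟨hr₀I, -⟩ := (hmem r₀).1 hr₀
    have hfc : ContinuousOn f (Icc (sL + η₀) R) := by
      have hyc : ContinuousOn y (Icc (sL + η₀) R) := (continuousOn_y S).mono fun r hr =>
        show 2 * M < r by linarith [hr.1]
      have h1 : ContinuousOn (fun r : ℝ => 1 + L / r ^ 2) (Icc (sL + η₀) R) :=
        continuousOn_const.add (continuousOn_const.div (by fun_prop) fun r hr => by
          have : 0 < r := by linarith [hr.1]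
          positivity)
      exact (continuousOn_const.sub hyc).rexp.mul h1.sqrt
    have hIcc : (Icc (sL + η₀) R).Nonempty := ⟨r₀, Ioo_subset_Icc_self hr₀I⟩
    obtain ⟨x, hx, hxmin⟩ := isCompact_Icc.exists_isMinOn hIcc hfc
    have hfx : f x < Real.exp z := (hxmin (Ioo_subset_Icc_self hr₀I)).trans_lt hr₀.2.1
    have hfx' := (one_add_div_mono hL).trans_lt (potential_lt_iff.1 hfx)
    have hxI : x ∈ Ioo (sL + η₀) R := by
      refine ⟨lt_of_le_of_ne hx.1 fun h => ?_, lt_of_le_of_ne hx.2 fun h => ?_⟩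
      · exact absurd hfx' (not_lt.2 (hlow x ⟨by linarith, h.ge⟩))
      · exact absurd hfx' (not_lt.2 (hhigh x h.ge))
    exact ⟨x, (hmem x).2 ⟨hxI, potential_lt_iff.1 hfx⟩,
      (hxmin.isLocalMin (Icc_mem_nhds hxI.1 hxI.2)).deriv_eq_zero⟩
  · have main : ∀ r₁ r₂, r₁ < r₂ → (r₁ ∈ Ioo (sL + η₀) R ∧ 1 + L / r₁ ^ 2 < Real.exp (2 * y r₁)) →
        deriv f r₁ = 0 → r₂ ∈ Ioo (sL + η₀) R → deriv f r₂ = 0 → False := by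
      rintro r₁ r₂ hlt ⟨hI₁, hw⟩ hd₁ hI₂ hd₂
      have hr₁2 : 2 * M < r₁ := by linarith [hI₁.1]
      have hr₁0 : 0 < r₁ := by linarith
      have hr₂0 : 0 < r₂ := hr₁0.trans hlt
      have hR0 : 0 < R := hr₁0.trans hI₁.2
      obtain ⟨hm₁, hp₁, hy₁⟩ := hbd r₁ (Ioo_subset_Icc_self hI₁)
      have hK0 : 0 ≤ K * δ := (P.p_nonneg (y := y) hδ.le hr₁0).trans hp₁
      have hLR : L ≤ R ^ 2 * Real.exp (2 * K) := by
        have h1 : L / r₁ ^ 2 ≤ Real.exp (2 * K) := by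
          have : Real.exp (2 * y r₁) ≤ Real.exp (2 * K) := Real.exp_le_exp.2 (by linarith)
          linarith
        rw [div_le_iff₀ (by positivity), mul_comm] at h1
        refine h1.trans ?_
        have := hI₁.2.le
        gcongr
      have hrR := hI₁.2.le
      have hmono : mFun M l L₀ δ sL Φ χ y r₁ ≤ mFun M l L₀ δ sL Φ χ y r₂ :=
        monotoneOn_Icc_of_hasDerivAt (fun x _ => P.hasDerivAt_mass S x) (fun x hx => by
          have := P.rho_nonneg (y := y) hδ.le (hr₁0.trans hx.1)
          positivity) (left_mem_Icc.2 hlt.le) (right_mem_Icc.2 hlt.le) hlt.le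
      have hm0 := P.mass_nonneg (y := y) hδ.le hr₁2
      have hp₁0 := P.p_nonneg (y := y) hδ.le hr₁0
      have hp0 := P.p_nonneg (y := y) hδ.le hr₂0
      have hpp := (abs_le.1 (hlip r₂ (Ioo_subset_Icc_self hI₂) r₁ (Ioo_subset_Icc_self hI₁))).1
      rw [abs_of_pos (sub_pos.2 hlt)] at hpp
      have hc₁ := P.critical_radius_eq hδ S hL0 hr₁2 hd₁
      have hc₂ := P.critical_radius_eq hδ S hL0 (hr₁2.trans hlt) hd₂
      set m₁ := mFun M l L₀ δ sL Φ χ y r₁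
      set m₂ := mFun M l L₀ δ sL Φ χ y r₂
      set p₁ := pFun l L₀ δ sL Φ χ y r₁
      set p₂ := pFun l L₀ δ sL Φ χ y r₂
      set Λ := R ^ 2 * Real.exp (2 * K) with hΛ
      have hΛ0 : 0 ≤ Λ := hL0.trans hLR
      have hs3 : 3 * M ≤ sL := by
        have h1 : 0 < M * sL ^ 2 := by have : 0 < sL := by linarith
                                       positivity
        rw [← hs] at h1
        linarith [pos_of_mul_pos_right h1 hL₀]
      refine no_two_critical_radii (A := (3 * Λ + R ^ 2) * K + 4 * π * (Λ * R ^ 3 + R ^ 5) * K)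
        (B := 4 * π * (Λ * R ^ 3 + R ^ 5) * B) (δ := δ) hM hη hL hs hs3 hI₁.1.le hlt
        hc₁ hc₂ ?_ ?_ ?_ hsmall
      · have e : ((3 * Λ + R ^ 2) * K + 4 * π * (Λ * R ^ 3 + R ^ 5) * K) * δ =
            (3 * Λ + R ^ 2) * (K * δ) + 4 * π * (Λ * R ^ 3 + R ^ 5) * (K * δ) := by ring
        rw [e]
        gcongr
      · have e1 : (3 * L + r₁ ^ 2) * m₁ ≤ (3 * L + r₂ ^ 2) * m₂ := by gcongr
        have e2 : 4 * π * (L * r₁ ^ 3 + r₁ ^ 5) * p₂ ≤ 4 * π * (L * r₂ ^ 3 + r₂ ^ 5) * p₂ := by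
          gcongr
        have e3 : 4 * π * (L * r₁ ^ 3 + r₁ ^ 5) * (-(B * δ * (r₂ - r₁))) ≤
            4 * π * (L * r₁ ^ 3 + r₁ ^ 5) * (p₂ - p₁) :=
          mul_le_mul_of_nonneg_left hpp (by positivity)
        have hd : 0 ≤ B * δ * (r₂ - r₁) := mul_nonneg (by positivity) (sub_pos.2 hlt).le
        have e4 : 4 * π * (L * r₁ ^ 3 + r₁ ^ 5) * (B * δ * (r₂ - r₁)) ≤
            4 * π * (Λ * R ^ 3 + R ^ 5) * (B * δ * (r₂ - r₁)) := by gcongr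
        linarith
      · have e : ((3 * Λ + R ^ 2) * K + 4 * π * (Λ * R ^ 3 + R ^ 5) * K) * δ =
            (3 * Λ + R ^ 2) * (K * δ) + 4 * π * (Λ * R ^ 3 + R ^ 5) * (K * δ) := by ring
        rw [e]
        positivity
    rintro r₁ r₂ ⟨h₁, hd₁⟩ ⟨h₂, hd₂⟩
    have k₁ := (hmem r₁).1 h₁
    have k₂ := (hmem r₂).1 h₂
    rcases lt_trichotomy r₁ r₂ with h | h | h
    · exact (main r₁ r₂ h k₁ hd₁ k₂.1 hd₂).elim
    · exact h
    · exact (main r₂ r₁ h k₂ hd₂ k₁.1 hd₁).elim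

end MatterModel

/-- An upper bound for `δ` that makes a nonnegative multiple of `δ` smaller than `t`. -/
theorem mul_lt_of_le_div_add_one {Q t δ : ℝ} (hQ : 0 ≤ Q) (ht : 0 < t) (hδ : δ ≤ t / (2 * (Q + 1)))
    (hδ0 : 0 < δ) : Q * δ < t := by
  rw [le_div_iff₀ (by positivity)] at hδ
  nlinarith

theorem stmt_8
    (M l α₀ L₀ E0 sL rL Rmin Rmax η₀ : ℝ)
    (Φ χ : ℝ → ℝ)
    (hM : 0 < M) (hl : -(1/2) < l)
    (hΦmeas : Measurable Φ) (hΦnonneg : ∀ x, 0 ≤ Φ x)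
    (hΦzero : ∀ x ≤ 0, Φ x = 0)
    (hα₀ : 0 < α₀) (hΦpos : ∀ x ∈ Ioo 0 α₀, 0 < Φ x)
    (hΦloc : ∀ a b : ℝ, BddAbove (Φ '' Icc a b))
    (hL₀ : 12 * M ^ 2 < L₀)
    (hsL : 2 * M < sL) (hsLrL : sL < rL)
    (hds : deriv (Psi0 M L₀) sL = 0) (hdr : deriv (Psi0 M L₀) rL = 0)
    (hmax : IsLocalMax (Psi0 M L₀) sL) (hmin : IsLocalMin (Psi0 M L₀) rL)
    (hE0l : Psi0 M L₀ rL < E0) (hE0u : E0 < min 1 (Psi0 M L₀ sL))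
    (hRmin1 : sL < Rmin) (hRmin2 : Rmin < rL) (hRmin3 : Psi0 M L₀ Rmin = E0)
    (hRmin4 : 4 * M < Rmin)
    (hRmax1 : rL < Rmax) (hRmax2 : Psi0 M L₀ Rmax = E0)
    (hη₀ : 0 < η₀) (hr₀η₀ : sL + η₀ < Rmin)
    (hχ : ContDiff ℝ (⊤ : ℕ∞) χ) (hχnonneg : ∀ x, 0 ≤ χ x)
    (hχ0 : ∀ x ≤ 0, χ x = 0) (hχ1 : ∀ x, η₀ ≤ x → χ x = 1)
    (Y : ℝ → ℝ → ℝ)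
    (hY : ∀ δ : ℝ, 0 ≤ δ →
      IsShellSolution M l L₀ δ sL (Real.log (Real.sqrt 2 * E0)) Φ χ (Y δ))
    (yinf : ℝ → ℝ)
    (hyinf : ∀ δ : ℝ, 0 ≤ δ → Tendsto (Y δ) atTop (𝓝 (yinf δ))) :
    ∃ δ₀ : ℝ, 0 < δ₀ ∧ ∀ δ : ℝ, 0 < δ → δ ≤ δ₀ → ∀ L : ℝ, L₀ ≤ L →
      ({r : ℝ | 2 * M < r ∧
          Real.exp (yinf δ - Y δ r) * Real.sqrt (1 + L / r ^ 2) < Real.exp (yinf δ) ∧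
          0 < rhoFun l L₀ δ sL Φ χ (Y δ) r}).Nonempty →
      ∃! rL' : ℝ,
        rL' ∈ {r : ℝ | 2 * M < r ∧
          Real.exp (yinf δ - Y δ r) * Real.sqrt (1 + L / r ^ 2) < Real.exp (yinf δ) ∧
          0 < rhoFun l L₀ δ sL Φ χ (Y δ) r} ∧
        deriv (fun r => Real.exp (yinf δ - Y δ r) * Real.sqrt (1 + L / r ^ 2)) rL' = 0 := by
  rcases (cConst_nonneg l).eq_or_lt with hc | hc
  · refine ⟨1, one_pos, fun δ _ _ L _ hne => ?_⟩
    obtain ⟨r, -, -, hr⟩ := hne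
    simp [rhoFun, Gfun, ← hc] at hr
  have P : MatterModel M l L₀ α₀ sL η₀ Φ χ := {
    hM := hM, hl := hl, hc := hc, hΦmeas := hΦmeas
    hΦ := intervalIntegrable_of_locallyBounded hΦmeas hΦnonneg hΦloc
    hΦ0 := hΦnonneg, hα₀ := hα₀, hΦpos := hΦpos, hL₀ := hL₀, hsL := hsL, hη₀ := hη₀, hχ := hχ
    hχnonneg := hχnonneg, hχ0 := hχ0, hχ1 := hχ1 }
  have hL₀0 : 0 < L₀ := by nlinarith [sq_pos_of_pos hM]
  have hE0 : 0 < E0 := (mul_nonneg (Real.sqrt_nonneg _) (Real.sqrt_nonneg _)).trans_lt hE0l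
  have hE1 : E0 < 1 := (lt_min_iff.1 hE0u).1
  have hs := Psi0_critical hM hL₀0.le hsL hds
  obtain ⟨R, hAR, hRneg⟩ := exists_vacuumY_neg (M := M) hE0 hE1 (max (4 * M) (sL + η₀))
  obtain ⟨hR4, hRη⟩ := max_lt_iff.1 hAR
  obtain ⟨c, hc0, hbar⟩ :=
    vacuum_barrier hM hL₀0 hsL hsLrL hds hdr hRmin2 hRmin3 hη₀ hr₀η₀
  have hsR : sL ≤ R := by linarith
  obtain ⟨δ₁, K, hδ₁, hK, hbd⟩ := P.exists_vacuum_bound hE0 hsR hR4.le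
  have hsL0 : 0 < sL := by linarith
  have hR0 : 0 < R := by linarith
  obtain ⟨KH, hKH, hH⟩ := Hfun_lipschitz (R := R) P.hΦ hΦnonneg hl hL₀0.le hsL0 K
  set B := KH * (1 + K) with hB
  have hB0 : 0 ≤ B := by positivity
  set Q := ((3 * (R ^ 2 * Real.exp (2 * K)) + R ^ 2) * K +
    4 * π * (R ^ 2 * Real.exp (2 * K) * R ^ 3 + R ^ 5) * K) +
      η₀ * (4 * π * (R ^ 2 * Real.exp (2 * K) * R ^ 3 + R ^ 5) * B) with hQ
  have hQ0 : 0 ≤ Q := by positivity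
  have hv0 : 0 < -vacuumY M E0 R := neg_pos.2 hRneg
  refine ⟨min (min δ₁ (c / (2 * (2 * K + 1))))
    (min (-vacuumY M E0 R / (2 * (K + 1))) (M * η₀ ^ 2 / (2 * (Q + 1)))), by positivity,
    fun δ hδ hδle L hL hne => ?_⟩
  obtain ⟨⟨h1, h2⟩, h3, h4⟩ : (δ ≤ δ₁ ∧ δ ≤ c / (2 * (2 * K + 1))) ∧
      δ ≤ -vacuumY M E0 R / (2 * (K + 1)) ∧ δ ≤ M * η₀ ^ 2 / (2 * (Q + 1)) := by
    simpa only [le_min_iff] using hδle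
  have hKc := mul_lt_of_le_div_add_one (by positivity) hc0 h2 hδ
  have hKv := mul_lt_of_le_div_add_one hK hv0 h3 hδ
  have S := hY δ hδ.le
  obtain ⟨hbd, hylip⟩ := hbd δ hδ h1 _ S
  have hsub : Icc sL R ⊆ Icc (min sL (4 * M)) R := Icc_subset_Icc_left (min_le_left _ _)
  have hsub' : Icc (sL + η₀) R ⊆ Icc sL R := Icc_subset_Icc_left (by linarith)
  refine P.existsUnique_critical_radius hδ S hB0 hs (fun r hr => ?_) (fun r hr => ?_)
    (fun r hr => ?_) (fun r hr r' hr' => ?_)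
    (mul_lt_of_le_div_add_one hQ0 (by positivity) h4 hδ) hL hne
  · have hy := (abs_le.1 (hbd r (hsub ⟨hr.1, by linarith [hr.2]⟩)).2.2.2.1).2
    have hb := hbar r hr
    have hpos : 0 < 1 + L₀ / r ^ 2 := by positivity
    rw [← Real.le_log_iff_exp_le hpos]
    linarith
  · have hy := (abs_le.1 (hbd R (hsub ⟨hsR, le_rfl⟩)).2.2.2.1).2
    have hanti := P.antitoneOn_y hδ.le S (by linarith : 2 * M < R) hr
    have h5 : Real.exp (2 * Y δ r) ≤ 1 := Real.exp_le_one_iff.2 (by linarith)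
    have h6 : 0 ≤ L₀ / r ^ 2 := by positivity
    linarith
  · obtain ⟨-, hp, hm, -, hy⟩ := hbd r (hsub (hsub' hr))
    exact ⟨hm, hp, (abs_le.1 hy).2⟩
  · have hχr : ∀ x ∈ Icc (sL + η₀) R, pFun l L₀ δ sL Φ χ (Y δ) x =
        δ * Hfun l L₀ Φ x (Y δ x) := fun x hx => by
      rw [pFun, hχ1 _ (by linarith [hx.1]), mul_one]
    have hyK : ∀ x ∈ Icc (sL + η₀) R, Y δ x ∈ Icc (-K) K := fun x hx =>
      abs_le.1 (hbd x (hsub (hsub' hx))).2.2.2.2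
    rw [hχr r hr, hχr r' hr', ← mul_sub, abs_mul, abs_of_pos hδ]
    calc δ * |Hfun l L₀ Φ r (Y δ r) - Hfun l L₀ Φ r' (Y δ r')|
        ≤ δ * (KH * (|r - r'| + |Y δ r - Y δ r'|)) := by
          gcongr
          exact hH r (hsub' hr) r' (hsub' hr') _ (hyK r hr) _ (hyK r' hr')
      _ ≤ δ * (KH * (|r - r'| + K * |r - r'|)) := by
          gcongr
          exact hylip r (hsub (hsub' hr)) r' (hsub (hsub' hr'))
      _ = B * δ * |r - r'| := by rw [hB]; ring

end
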